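/- arXiv:2401.13665 — 4 statements merged into one kernel-verified Lean document; each statement's English description precedes it below -/
import Mathlib

section
/- Under the four-block setup and the sub-block condition, the local minimax risk of the genie-aided estimation problem at scale ε* := √σr*·max{1/√N, 1/√T} satisfies R_loc(ε*) ≥ (1 − (c_u·π²/c_ℓ²)·ε²_{N,T})·γ*_{i,t}, where ε_{N,T} := (ω/σr*)/√min{N1,T1}. -/
open Matrix MeasureTheory ProbabilityTheory
open scoped BigOperators ENNReal

noncomputable section

/-- Euclidean norm of a finite-dimensional real vector. -/
def vnorm {n : Type*} [Fintype n] (v : n → ℝ) : ℝ := Real.sqrt (∑ j, (v j) ^ 2)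

/-- Frobenius norm of a real matrix. -/
def frob {m n : Type*} [Fintype m] [Fintype n] (A : Matrix m n ℝ) : ℝ :=
  Real.sqrt (∑ i, ∑ j, (A i j) ^ 2)

/-- Spectral (ℓ₂ operator) norm of a real matrix. -/
def spec {m n : Type*} [Fintype m] [Fintype n] [DecidableEq n] (A : Matrix m n ℝ) : ℝ :=
  ‖LinearMap.toContinuousLinearMap (Matrix.toEuclideanLin A)‖

/-- `sval A k`: the k-th largest singular value of `A` (Courant–Fischer max–min). -/
def sval {m n : Type*} [Fintype m] [Fintype n] [DecidableEq n]
    (A : Matrix m n ℝ) (k : ℕ) : ℝ :=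
  ⨆ W : {W : Submodule ℝ (EuclideanSpace ℝ n) // Module.finrank ℝ ↥W = k},
    ⨅ x : {x : EuclideanSpace ℝ n // x ∈ W.1 ∧ ‖x‖ = 1},
      ‖Matrix.toEuclideanLin A x.1‖

/-- `(U, s, V)` is a rank-`r` truncated SVD of `A`. -/
structure IsTruncSVD {m n : ℕ} (r : ℕ) (A : Matrix (Fin m) (Fin n) ℝ)
    (U : Matrix (Fin m) (Fin r) ℝ) (s : Fin r → ℝ) (V : Matrix (Fin n) (Fin r) ℝ) : Prop where
  orthU : Uᵀ * U = 1
  orthV : Vᵀ * V = 1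
  nonneg : ∀ k, 0 ≤ s k
  anti : ∀ k l : Fin r, k ≤ l → s l ≤ s k
  right : A * V = U * Matrix.diagonal s
  left : Aᵀ * U = V * Matrix.diagonal s
  top : ∀ k : Fin r, s k = sval A (k.1 + 1)

/-- `H` is the orthogonal polar factor (the "matrix sign") of `A`. -/
def IsPolarSign {r : ℕ} (A H : Matrix (Fin r) (Fin r) ℝ) : Prop :=
  Hᵀ * H = 1 ∧ H * Hᵀ = 1 ∧ (Hᵀ * A).PosSemidef

/-- The submatrix of the top `N1` rows. -/
def topRows {N r N1 : ℕ} (h : N1 ≤ N) (A : Matrix (Fin N) (Fin r) ℝ) :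
    Matrix (Fin N1) (Fin r) ℝ :=
  A.submatrix (Fin.castLE h) id


structure GTilt {Ω : Type*} [MeasurableSpace Ω] (P : ℝ → Measure Ω) (S : Ω → ℝ) (I : ℝ) : Prop where
  prob : ∀ θ, IsProbabilityMeasure (P θ)
  meas : Measurable S
  dens : ∀ θ, P θ = (P 0).withDensity
    (fun z => ENNReal.ofReal (Real.exp (θ * S z - θ ^ 2 * I / 2)))
  memLp : ∀ θ, MemLp S 2 (P θ)
  mean : ∀ θ, ∫ z, S z ∂(P θ) = θ * I
  var : ∀ θ, Var[S; P θ] = I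

lemma tilt_gauss (m d : ℝ) (v : NNReal) (hv : v ≠ 0) :
    GTilt (fun θ => gaussianReal (m + θ * d) v) (fun z => d / v * (z - m)) (d ^ 2 / v) := by
  have hv' : (v : ℝ) ≠ 0 := by exact_mod_cast hv
  have hL : ∀ θ : ℝ, MemLp (fun z : ℝ => z - m) 2 (gaussianReal (m + θ * d) v) := fun θ =>
    (memLp_id_gaussianReal' 2 (by simp)).sub (memLp_const m)
  refine ⟨fun θ => inferInstance, by fun_prop, fun θ => ?_, fun θ => ?_, fun θ => ?_, fun θ => ?_⟩
  · rw [gaussianReal_of_var_ne_zero _ hv, gaussianReal_of_var_ne_zero _ hv,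
      ← withDensity_mul _ (measurable_gaussianPDF _ _) (by fun_prop)]
    congr 1
    ext z
    simp only [Pi.mul_apply, gaussianPDF, gaussianPDFReal]
    rw [← ENNReal.ofReal_mul (by positivity),
      mul_assoc _ (Real.exp _) (Real.exp _), ← Real.exp_add]
    congr 3
    field_simp
    ring
  · exact (hL θ).const_mul _
  · rw [integral_const_mul, integral_sub, integral_id_gaussianReal]
    · simp; field_simp
    · exact (memLp_id_gaussianReal' (μ := m + θ * d) (v := v) 1 (by simp)).integrable le_rfl
    · exact integrable_const _
  · rw [variance_const_mul, variance_sub_const (by fun_prop), variance_fun_id_gaussianReal]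
    field_simp

lemma pi_withDensity' {ι : Type*} [Fintype ι] (μ : ι → Measure ℝ)
    [∀ i, IsProbabilityMeasure (μ i)] (f : ι → ℝ → ℝ≥0∞) (hf : ∀ i, Measurable (f i))
    [∀ i, IsProbabilityMeasure ((μ i).withDensity (f i))] :
    Measure.pi (fun i => (μ i).withDensity (f i)) =
      (Measure.pi μ).withDensity (fun z => ∏ i, f i (z i)) := by
  refine Measure.pi_eq fun s hs => ?_
  rw [withDensity_apply _ (MeasurableSet.univ_pi hs),
    ← lintegral_indicator (MeasurableSet.univ_pi hs)]
  have h1 : (fun z : ι → ℝ => (Set.univ.pi s).indicator (fun z => ∏ i, f i (z i)) z)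
      = fun z => ∏ i, (s i).indicator (f i) (z i) := by
    ext z
    by_cases hz : z ∈ Set.univ.pi s
    · rw [Set.indicator_of_mem hz]
      refine Finset.prod_congr rfl fun i _ => ?_
      rw [Set.indicator_of_mem (hz i (Set.mem_univ i))]
    · rw [Set.indicator_of_notMem hz]
      simp only [Set.mem_pi, Set.mem_univ, true_imp_iff, not_forall] at hz
      obtain ⟨i, hi⟩ := hz
      exact (Finset.prod_eq_zero (Finset.mem_univ i) (Set.indicator_of_notMem hi _)).symm
  rw [h1, lintegral_prod_eq_prod_lintegral_of_indepFun Finset.univ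
    (fun i (z : ι → ℝ) => (s i).indicator (f i) (z i))]
  · refine Finset.prod_congr rfl fun i _ => ?_
    rw [withDensity_apply _ (hs i), ← lintegral_indicator (hs i)]
    exact ((measurePreserving_eval μ i).lintegral_comp ((hf i).indicator (hs i)))
  · exact iIndepFun_pi fun i => ((hf i).indicator (hs i)).aemeasurable
  · exact fun i => ((hf i).indicator (hs i)).comp (measurable_pi_apply i)

lemma tilt_pi {ι : Type*} [Fintype ι] (P : ι → ℝ → Measure ℝ) (S : ι → ℝ → ℝ) (I : ι → ℝ)
    (h : ∀ i, GTilt (P i) (S i) (I i)) :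
    GTilt (fun θ => Measure.pi (fun i => P i θ)) (fun z => ∑ i, S i (z i)) (∑ i, I i) := by
  have hp : ∀ θ i, IsProbabilityMeasure (P i θ) := fun θ i => (h i).prob θ
  refine ⟨fun θ => inferInstance, ?_, fun θ => ?_, fun θ => ?_, fun θ => ?_, fun θ => ?_⟩
  · exact Finset.measurable_sum _ fun i _ => (h i).meas.comp (measurable_pi_apply i)
  · have hd := fun i => (h i).dens θ
    have : ∀ i, IsProbabilityMeasure ((P i 0).withDensity
      (fun z => ENNReal.ofReal (Real.exp (θ * S i z - θ ^ 2 * I i / 2)))) := fun i => by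
      rw [← hd i]; infer_instance
    have e : (fun i => P i θ) = fun i => (P i 0).withDensity
      (fun z => ENNReal.ofReal (Real.exp (θ * S i z - θ ^ 2 * I i / 2))) := funext hd
    simp only [e]
    rw [pi_withDensity']
    · congr 1
      ext z
      rw [← ENNReal.ofReal_prod_of_nonneg (fun i _ => (Real.exp_pos _).le), ← Real.exp_sum]
      congr 2
      rw [Finset.sum_sub_distrib, Finset.mul_sum, Finset.mul_sum, Finset.sum_div]
    · intro i
      have := (h i).meas
      fun_prop
  · exact memLp_finsetSum _ fun i _ =>
      ((h i).memLp θ).comp_measurePreserving (measurePreserving_eval _ i)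
  · rw [integral_finsetSum, Finset.mul_sum]
    · refine Finset.sum_congr rfl fun i _ => ?_
      rw [integral_comp_eval (μ := fun i => P i θ) (i := i) (f := S i)
        (h i).meas.aestronglyMeasurable, (h i).mean θ]
    · intro i _
      exact integrable_comp_eval (((h i).memLp θ).integrable (by norm_num))
  · have := variance_sum_pi (μ := fun i => P i θ) (X := S) (fun i => (h i).memLp θ)
    rw [Finset.sum_congr rfl fun i _ => (h i).var θ] at this
    rw [← this]
    congr 1
    ext z
    simp

lemma tilt_prod {Ω Ω' : Type*} [MeasurableSpace Ω] [MeasurableSpace Ω'] (P : ℝ → Measure Ω)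
    (Q : ℝ → Measure Ω') (S : Ω → ℝ) (S' : Ω' → ℝ) (I J : ℝ)
    (h : GTilt P S I) (k : GTilt Q S' J) :
    GTilt (fun θ => (P θ).prod (Q θ)) (fun z => S z.1 + S' z.2) (I + J) := by
  have hp := h.prob
  have kp := k.prob
  have hm := h.meas
  have km := k.meas
  refine ⟨fun θ => inferInstance, by fun_prop, fun θ => ?_, fun θ => ?_, fun θ => ?_, fun θ => ?_⟩
  · have e1 := h.dens θ
    have e2 := k.dens θ
    show (P θ).prod (Q θ) = _
    rw [e1, e2, prod_withDensity (by fun_prop) (by fun_prop)]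
    congr 1
    ext z
    rw [← ENNReal.ofReal_mul (by positivity), ← Real.exp_add]
    congr 2
    ring
  · exact ((h.memLp θ).comp_fst _).add ((k.memLp θ).comp_snd _)
  · have i1 := (((h.memLp θ).comp_fst (Q θ))).integrable (q := 2) (by norm_num)
    have i2 := (((k.memLp θ).comp_snd (P θ))).integrable (q := 2) (by norm_num)
    rw [integral_add i1 i2, integral_fun_fst (f := S), integral_fun_snd (f := S'), h.mean, k.mean]
    simp
    ring
  · rw [variance_add_prod (h.memLp θ) (k.memLp θ), h.var, k.var]

lemma GTilt.nonneg {Ω : Type*} [MeasurableSpace Ω] {P : ℝ → Measure Ω} {S : Ω → ℝ} {I : ℝ}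
    (h : GTilt P S I) : 0 ≤ I := by
  rw [← h.var 0]; exact variance_nonneg _ _

lemma GTilt.mom {Ω : Type*} [MeasurableSpace Ω] {P : ℝ → Measure Ω} {S : Ω → ℝ} {I : ℝ}
    (h : GTilt P S I) (θ A a b : ℝ) :
    Integrable (fun z => A + (a * (S z - θ * I) - b) ^ 2) (P θ) ∧
      ∫ z, (A + (a * (S z - θ * I) - b) ^ 2) ∂(P θ) = A + (a ^ 2 * I + b ^ 2) := by
  have := h.prob θ
  have m1 : MemLp (fun z => S z - θ * I) 2 (P θ) := (h.memLp θ).sub (memLp_const _)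
  have i1 : Integrable (fun z => S z - θ * I) (P θ) := m1.integrable (by norm_num)
  have i2 : Integrable (fun z => (S z - θ * I) ^ 2) (P θ) := m1.integrable_sq
  have e1 : ∫ z, (S z - θ * I) ∂(P θ) = 0 := by
    rw [integral_sub ((h.memLp θ).integrable (by norm_num)) (integrable_const _), h.mean]; simp
  have e2 : ∫ z, (S z - θ * I) ^ 2 ∂(P θ) = I := by
    have := h.var θ
    rw [variance_eq_integral h.meas.aemeasurable, h.mean] at this
    exact this
  have e : (fun z => A + (a * (S z - θ * I) - b) ^ 2) =
      fun z => (a ^ 2 * (S z - θ * I) ^ 2 + (-2 * a * b) * (S z - θ * I)) + (A + b ^ 2) := by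
    ext z; ring
  rw [e]
  have j : Integrable (fun z => a ^ 2 * (S z - θ * I) ^ 2 + (-2 * a * b) * (S z - θ * I)) (P θ) :=
    (i2.const_mul (a ^ 2)).add (i1.const_mul (-2 * a * b))
  refine ⟨j.add (integrable_const _), ?_⟩
  rw [integral_add j (integrable_const _), integral_add (i2.const_mul (a ^ 2))
    (i1.const_mul (-2 * a * b)), integral_const_mul, integral_const_mul, e1, e2]
  simp
  ring

lemma GTilt.mom0 {Ω : Type*} [MeasurableSpace Ω] {P : ℝ → Measure Ω} {S : Ω → ℝ} {I : ℝ}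
    (h : GTilt P S I) (θ A a b : ℝ) :
    Integrable (fun z => Real.exp (θ * S z - θ ^ 2 * I / 2) *
        (A + (a * (S z - θ * I) - b) ^ 2)) (P 0) ∧
      ∫ z, Real.exp (θ * S z - θ ^ 2 * I / 2) * (A + (a * (S z - θ * I) - b) ^ 2) ∂(P 0)
        = A + (a ^ 2 * I + b ^ 2) := by
  have hm := h.meas
  obtain ⟨h1, h2⟩ := h.mom θ A a b
  rw [h.dens θ] at h1 h2
  rw [integrable_withDensity_iff_integrable_smul' (by fun_prop) (by simp)] at h1
  rw [integral_withDensity_eq_integral_toReal_smul (by fun_prop) (by simp)] at h2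
  simp only [ENNReal.toReal_ofReal (Real.exp_pos _).le, smul_eq_mul] at h1 h2
  exact ⟨h1, h2⟩

lemma ofReal_integral_le_lint {Ω : Type*} [MeasurableSpace Ω] {μ : Measure Ω} {h : Ω → ℝ}
    (hi : Integrable h μ) : ENNReal.ofReal (∫ z, h z ∂μ) ≤ ∫⁻ z, ENNReal.ofReal (h z) ∂μ := by
  have h1 : ∫ z, h z ∂μ ≤ ∫ z, max (h z) 0 ∂μ :=
    integral_mono hi hi.pos_part fun z => le_max_left _ _
  refine (ENNReal.ofReal_le_ofReal h1).trans ?_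
  rw [ofReal_integral_eq_lintegral_ofReal hi.pos_part
    (Filter.Eventually.of_forall fun z => le_max_right _ _)]
  refine lintegral_mono fun z => ?_
  rcases le_total (h z) 0 with h0 | h0
  · simp [max_eq_right h0]
  · simp [max_eq_left h0]

/-- pointwise inequality -/
lemma pointwise_ineq (B : ℝ) (hB : 0 < B) (f g0 L K I s l : ℝ) :
    ∫ θ in (-B)..B, Real.exp (θ * s - θ ^ 2 * I / 2) *
      (2 * l * (L + 2 * θ * K) * Real.cos (Real.pi / (2 * B) * θ) ^ 2
        - (l * Real.cos (Real.pi / (2 * B) * θ) * (s - θ * I)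
            - l * (Real.pi / B) * Real.sin (Real.pi / (2 * B) * θ)) ^ 2) ≤
    ∫ θ in (-B)..B, Real.exp (θ * s - θ ^ 2 * I / 2) *
      (Real.cos (Real.pi / (2 * B) * θ) ^ 2 * (f - (g0 + θ * L + θ ^ 2 * K)) ^ 2) := by
  set k := Real.pi / (2 * B) with hk
  have hkB : k * B = Real.pi / 2 := by rw [hk]; field_simp
  have hk2 : Real.pi / B = 2 * k := by rw [hk]; field_simp
  rw [hk2]
  have ibp := intervalIntegral.integral_mul_deriv_eq_deriv_mul (a := -B) (b := B)
    (u := fun θ => f - (g0 + θ * L + θ ^ 2 * K)) (u' := fun θ => -(L + 2 * θ * K))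
    (v := fun θ => Real.exp (θ * s - θ ^ 2 * I / 2) * Real.cos (k * θ) ^ 2)
    (v' := fun θ => Real.exp (θ * s - θ ^ 2 * I / 2) * (Real.cos (k * θ) ^ 2 * (s - θ * I)
      - 2 * k * Real.cos (k * θ) * Real.sin (k * θ))) ?_ ?_ ?_ ?_
  · have c1 : Real.cos (k * B) = 0 := by rw [hkB]; exact Real.cos_pi_div_two
    have c2 : Real.cos (k * -B) = 0 := by rw [mul_neg, Real.cos_neg, c1]
    simp only [c1, c2] at ibp
    have ibp' : ∫ θ in (-B)..B, Real.exp (θ * s - θ ^ 2 * I / 2) *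
          (2 * l * (L + 2 * θ * K) * Real.cos (k * θ) ^ 2)
        = ∫ θ in (-B)..B, (2 * l) * ((f - (g0 + θ * L + θ ^ 2 * K)) *
          (Real.exp (θ * s - θ ^ 2 * I / 2) * (Real.cos (k * θ) ^ 2 * (s - θ * I)
            - 2 * k * Real.cos (k * θ) * Real.sin (k * θ)))) := by
      rw [intervalIntegral.integral_const_mul, ibp]
      have e : (fun x => -(L + 2 * x * K) * (Real.exp (x * s - x ^ 2 * I / 2) *
          Real.cos (k * x) ^ 2)) = fun x => -((L + 2 * x * K) *
            (Real.exp (x * s - x ^ 2 * I / 2) * Real.cos (k * x) ^ 2)) := by ext x; ring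
      rw [e, intervalIntegral.integral_neg]
      simp only [ne_eq, OfNat.ofNat_ne_zero, not_false_eq_true, zero_pow, mul_zero, sub_zero,
        zero_sub, neg_neg]
      rw [← intervalIntegral.integral_const_mul]
      congr 1
      ext x
      ring
    simp only [mul_sub (Real.exp _)]
    rw [intervalIntegral.integral_sub, ibp', ← intervalIntegral.integral_sub]
    · refine intervalIntegral.integral_mono_on (by linarith) ?_ ?_ ?_
      · exact Continuous.intervalIntegrable (by fun_prop) _ _
      · exact Continuous.intervalIntegrable (by fun_prop) _ _
      · intro θ _
        have := Real.exp_pos (θ * s - θ ^ 2 * I / 2)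
        have h := mul_nonneg this.le (sq_nonneg (Real.cos (k * θ) * (f - (g0 + θ * L + θ ^ 2 * K))
          - (l * Real.cos (k * θ) * (s - θ * I) - l * (2 * k) * Real.sin (k * θ))))
        linarith
    all_goals exact Continuous.intervalIntegrable (by fun_prop) _ _
  · intro θ _
    have h1 := (((hasDerivAt_id θ).mul_const L).const_add g0).add
      (((hasDerivAt_id θ).pow 2).mul_const K)
    have h2 := h1.const_sub f
    convert! h2 using 1
    simp
  · intro θ _
    have h1 := (((hasDerivAt_id θ).mul_const s).sub
      ((((hasDerivAt_id θ).pow 2).mul_const I).div_const 2)).exp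
    have h2 := (((hasDerivAt_id θ).const_mul k).cos).pow 2
    have h3 := h1.mul h2
    convert! h3 using 1
    simp
    ring
  all_goals exact Continuous.intervalIntegrable (by fun_prop) _ _

lemma int_c2 (B : ℝ) (hB : 0 < B) :
    ∫ θ in (-B)..B, Real.cos (Real.pi / (2 * B) * θ) ^ 2 = B := by
  have hk : Real.pi / (2 * B) ≠ 0 := by positivity
  have hkB : Real.pi / (2 * B) * B = Real.pi / 2 := by field_simp
  rw [intervalIntegral.integral_comp_mul_left (fun x => Real.cos x ^ 2) hk, integral_cos_sq,
    mul_neg, hkB]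
  simp
  field_simp

lemma int_tc2 (B : ℝ) :
    ∫ θ in (-B)..B, θ * Real.cos (Real.pi / (2 * B) * θ) ^ 2 = 0 := by
  have h := intervalIntegral.integral_comp_neg (a := -B) (b := B)
    (fun θ => θ * Real.cos (Real.pi / (2 * B) * θ) ^ 2)
  simp only [mul_neg, Real.cos_neg, neg_mul, neg_neg, intervalIntegral.integral_neg] at h
  linarith

lemma int_all (B : ℝ) (hB : 0 < B) (L K I l : ℝ) :
    ∫ θ in (-B)..B, (2 * l * (L + 2 * θ * K) * Real.cos (Real.pi / (2 * B) * θ) ^ 2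
        - ((l * Real.cos (Real.pi / (2 * B) * θ)) ^ 2 * I
            + (l * (Real.pi / B) * Real.sin (Real.pi / (2 * B) * θ)) ^ 2))
      = B * (2 * l * L - l ^ 2 * (I + Real.pi ^ 2 / B ^ 2)) := by
  have e : ∀ θ : ℝ, (2 * l * (L + 2 * θ * K) * Real.cos (Real.pi / (2 * B) * θ) ^ 2
        - ((l * Real.cos (Real.pi / (2 * B) * θ)) ^ 2 * I
            + (l * (Real.pi / B) * Real.sin (Real.pi / (2 * B) * θ)) ^ 2))
      = (2 * l * L - l ^ 2 * I + l ^ 2 * (Real.pi / B) ^ 2) * Real.cos (Real.pi / (2 * B) * θ) ^ 2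
        + (4 * l * K) * (θ * Real.cos (Real.pi / (2 * B) * θ) ^ 2)
        - l ^ 2 * (Real.pi / B) ^ 2 := by
    intro θ
    have := Real.sin_sq_add_cos_sq (Real.pi / (2 * B) * θ)
    have h : Real.sin (Real.pi / (2 * B) * θ) ^ 2 = 1 - Real.cos (Real.pi / (2 * B) * θ) ^ 2 := by
      linarith
    rw [mul_pow (l * (Real.pi / B)), h]
    ring
  simp only [e]
  rw [intervalIntegral.integral_sub, intervalIntegral.integral_add,
    intervalIntegral.integral_const_mul, intervalIntegral.integral_const_mul, int_c2 B hB,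
    int_tc2, intervalIntegral.integral_const]
  · simp only [smul_eq_mul]; ring
  all_goals exact Continuous.intervalIntegrable (by fun_prop) _ _

lemma van_trees {Ω : Type*} [MeasurableSpace Ω] {P : ℝ → Measure Ω} {S : Ω → ℝ} {I : ℝ}
    (h : GTilt P S I) (B : ℝ) (hB : 0 < B) (f : Ω → ℝ) (hf : Measurable f) (g0 L K : ℝ)
    (R : ℝ≥0∞) (hR : ∀ θ, |θ| ≤ B →
      ∫⁻ z, ENNReal.ofReal ((f z - (g0 + θ * L + θ ^ 2 * K)) ^ 2) ∂(P θ) ≤ R) :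
    ENNReal.ofReal (L ^ 2 / (I + Real.pi ^ 2 / B ^ 2)) ≤ R := by
  have hI := h.nonneg
  have hS := h.meas
  have hP0 := h.prob 0
  set D := I + Real.pi ^ 2 / B ^ 2 with hD
  have hDpos : 0 < D := by positivity
  set l := L / D with hl
  set μ : Measure ℝ := volume.restrict (Set.Ioc (-B) B) with hμ
  let H : Ω → ℝ → ℝ := fun z θ => Real.exp (θ * S z - θ ^ 2 * I / 2) *
      (2 * l * (L + 2 * θ * K) * Real.cos (Real.pi / (2 * B) * θ) ^ 2
        - (l * Real.cos (Real.pi / (2 * B) * θ) * (S z - θ * I)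
            - l * (Real.pi / B) * Real.sin (Real.pi / (2 * B) * θ)) ^ 2)
  let F : Ω → ℝ → ℝ := fun z θ => Real.exp (θ * S z - θ ^ 2 * I / 2) *
      (Real.cos (Real.pi / (2 * B) * θ) ^ 2 * (f z - (g0 + θ * L + θ ^ 2 * K)) ^ 2)
  have hFm : Measurable (Function.uncurry F) := by
    simp only [F, Function.uncurry_def]; fun_prop
  have hHm : Measurable (Function.uncurry H) := by
    simp only [H, Function.uncurry_def]; fun_prop
  -- slices of H
  have hHθ : ∀ θ, Integrable (fun z => H z θ) (P 0) ∧ ∫ z, H z θ ∂(P 0) =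
      (2 * l * (L + 2 * θ * K) * Real.cos (Real.pi / (2 * B) * θ) ^ 2
        - ((l * Real.cos (Real.pi / (2 * B) * θ)) ^ 2 * I
            + (l * (Real.pi / B) * Real.sin (Real.pi / (2 * B) * θ)) ^ 2)) := by
    intro θ
    obtain ⟨a1, a2⟩ := h.mom0 θ (-(2 * l * (L + 2 * θ * K) * Real.cos (Real.pi / (2 * B) * θ) ^ 2))
      (l * Real.cos (Real.pi / (2 * B) * θ)) (l * (Real.pi / B) * Real.sin (Real.pi / (2 * B) * θ))
    have e : (fun z => H z θ) = fun z => -(Real.exp (θ * S z - θ ^ 2 * I / 2) *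
        (-(2 * l * (L + 2 * θ * K) * Real.cos (Real.pi / (2 * B) * θ) ^ 2) +
          (l * Real.cos (Real.pi / (2 * B) * θ) * (S z - θ * I)
            - l * (Real.pi / B) * Real.sin (Real.pi / (2 * B) * θ)) ^ 2)) := by
      ext z; simp only [H]; ring
    rw [e, integral_neg, a2]
    exact ⟨a1.neg, by ring⟩
  have hHb : ∀ θ, |θ| ≤ B → ‖∫ z, ‖H z θ‖ ∂(P 0)‖ ≤
      2 * |l| * (|L| + 2 * B * |K|) + (l ^ 2 * I + (l * (Real.pi / B)) ^ 2) := by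
    intro θ hθ
    rw [Real.norm_of_nonneg (integral_nonneg fun _ => norm_nonneg _)]
    obtain ⟨a1, a2⟩ := h.mom0 θ (|2 * l * (L + 2 * θ * K) * Real.cos (Real.pi / (2 * B) * θ) ^ 2|)
      (l * Real.cos (Real.pi / (2 * B) * θ)) (l * (Real.pi / B) * Real.sin (Real.pi / (2 * B) * θ))
    refine (integral_mono (hHθ θ).1.norm a1 ?_).trans ?_
    · intro z
      simp only [H, norm_mul, Real.norm_eq_abs, abs_of_pos (Real.exp_pos _)]
      refine mul_le_mul_of_nonneg_left ?_ (Real.exp_pos _).le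
      exact (abs_sub _ _).trans (add_le_add le_rfl (abs_of_nonneg (sq_nonneg _)).le)
    · rw [a2]
      have c1 := Real.cos_sq_le_one (Real.pi / (2 * B) * θ)
      have s1 := Real.sin_sq_le_one (Real.pi / (2 * B) * θ)
      refine add_le_add ?_ (add_le_add ?_ ?_)
      · rw [abs_mul, abs_mul, abs_mul, abs_two, abs_of_nonneg (sq_nonneg (Real.cos _))]
        refine (mul_le_of_le_one_right (by positivity) c1).trans ?_
        refine mul_le_mul_of_nonneg_left ?_ (by positivity)
        refine (abs_add_le _ _).trans ?_
        rw [abs_mul, abs_mul, abs_two]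
        gcongr
      · rw [mul_pow]
        refine mul_le_mul_of_nonneg_right ?_ hI
        exact mul_le_of_le_one_right (by positivity) c1
      · rw [mul_pow (l * (Real.pi / B))]
        exact mul_le_of_le_one_right (by positivity) s1
  have hIoc : ∀ θ ∈ Set.Ioc (-B) B, |θ| ≤ B := fun θ hθ => abs_le.2 ⟨hθ.1.le, hθ.2⟩
  have hHi : Integrable (Function.uncurry H) ((P 0).prod μ) := by
    rw [integrable_prod_iff' hHm.aestronglyMeasurable]
    refine ⟨Filter.Eventually.of_forall fun θ => (hHθ θ).1, ?_⟩
    refine Integrable.of_bound (C := 2 * |l| * (|L| + 2 * B * |K|) +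
      (l ^ 2 * I + (l * (Real.pi / B)) ^ 2)) ?_ ?_
    · exact (StronglyMeasurable.integral_prod_left'
        (f := fun q : Ω × ℝ => ‖Function.uncurry H q‖)
        hHm.norm.stronglyMeasurable).aestronglyMeasurable
    · refine (ae_restrict_iff' measurableSet_Ioc).2 (Filter.Eventually.of_forall fun θ hθ => ?_)
      exact hHb θ (hIoc θ hθ)
  -- lower bound
  have key : ENNReal.ofReal (B * (L ^ 2 / D)) ≤ ∫⁻ z, ∫⁻ θ, ENNReal.ofReal (F z θ) ∂μ ∂(P 0) := by
    have e1 : B * (L ^ 2 / D) = ∫ z, ∫ θ, H z θ ∂μ ∂(P 0) := by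
      rw [integral_integral_swap hHi]
      simp only [fun θ => (hHθ θ).2]
      rw [hμ, ← intervalIntegral.integral_of_le (by linarith), int_all B hB, ← hD, hl]
      field_simp
      ring
    rw [e1]
    refine (ofReal_integral_le_lint hHi.integral_prod_left).trans (lintegral_mono fun z => ?_)
    have hFi : Integrable (F z) μ := by
      have : IntervalIntegrable (F z) volume (-B) B :=
        Continuous.intervalIntegrable (by simp only [F]; fun_prop) _ _
      rwa [intervalIntegrable_iff_integrableOn_Ioc_of_le (by linarith)] at this
    rw [← ofReal_integral_eq_lintegral_ofReal hFi
      (Filter.Eventually.of_forall fun θ => by simp only [F]; positivity)]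
    refine ENNReal.ofReal_le_ofReal ?_
    have := pointwise_ineq B hB (f z) g0 L K I (S z) l
    rw [intervalIntegral.integral_of_le (by linarith),
      intervalIntegral.integral_of_le (by linarith)] at this
    exact this
  have key2 : ∫⁻ z, ∫⁻ θ, ENNReal.ofReal (F z θ) ∂μ ∂(P 0) ≤ ENNReal.ofReal B * R := by
    rw [lintegral_lintegral_swap (f := fun z θ => ENNReal.ofReal (F z θ))
      hFm.ennreal_ofReal.aemeasurable]
    have e2 : ENNReal.ofReal B = ∫⁻ θ, ENNReal.ofReal (Real.cos (Real.pi / (2 * B) * θ) ^ 2) ∂μ := by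
      rw [← ofReal_integral_eq_lintegral_ofReal]
      · rw [hμ, ← intervalIntegral.integral_of_le (by linarith), int_c2 B hB]
      · have : IntervalIntegrable (fun θ => Real.cos (Real.pi / (2 * B) * θ) ^ 2) volume (-B) B :=
          Continuous.intervalIntegrable (by fun_prop) _ _
        rwa [intervalIntegrable_iff_integrableOn_Ioc_of_le (by linarith)] at this
      · exact Filter.Eventually.of_forall fun θ => by positivity
    rw [e2, ← lintegral_mul_const _ (by fun_prop)]
    refine lintegral_mono_ae ?_
    refine (ae_restrict_iff' measurableSet_Ioc).2 (Filter.Eventually.of_forall fun θ hθ => ?_)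
    have hr := hR θ (hIoc θ hθ)
    rw [h.dens θ, lintegral_withDensity_eq_lintegral_mul _ (by fun_prop) (by fun_prop)] at hr
    have e3 : ∀ z, ENNReal.ofReal (F z θ) = ENNReal.ofReal (Real.cos (Real.pi / (2 * B) * θ) ^ 2) *
        ((fun z => ENNReal.ofReal (Real.exp (θ * S z - θ ^ 2 * I / 2))) *
          fun z => ENNReal.ofReal ((f z - (g0 + θ * L + θ ^ 2 * K)) ^ 2)) z := by
      intro z
      simp only [Pi.mul_apply, F]
      rw [← ENNReal.ofReal_mul (by positivity), ← ENNReal.ofReal_mul (by positivity)]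
      congr 1
      ring
    simp only [e3]
    rw [lintegral_const_mul _ (by fun_prop)]
    gcongr
  have key3 := key.trans key2
  rw [ENNReal.ofReal_mul hB.le] at key3
  exact (ENNReal.mul_le_mul_iff_right (by simpa using hB) (by simp)).1 key3

lemma lin_alg {r n : ℕ} (W : Matrix (Fin n) (Fin r) ℝ) (κ : ℝ) (hκ : 0 < κ)
    (h : (Wᵀ * W - κ • (1 : Matrix (Fin r) (Fin r) ℝ)).PosSemidef) (u : Fin r → ℝ) :
    (∑ j, (W j ⬝ᵥ (Wᵀ * W)⁻¹.mulVec u) ^ 2 = u ⬝ᵥ (Wᵀ * W)⁻¹.mulVec u) ∧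
    (∀ k, ((Wᵀ * W)⁻¹.mulVec u k) ^ 2 ≤ (u ⬝ᵥ (Wᵀ * W)⁻¹.mulVec u) / κ) := by
  have hpd : (Wᵀ * W).PosDef := by
    have h1 : (κ • (1 : Matrix (Fin r) (Fin r) ℝ)).PosDef := Matrix.PosDef.one.smul hκ
    have := h1.add_posSemidef h
    simpa using this
  have hu : IsUnit (Wᵀ * W).det := hpd.det_pos.ne'.isUnit
  set q := (Wᵀ * W)⁻¹.mulVec u with hq
  have hAq : (Wᵀ * W).mulVec q = u := by
    rw [hq, Matrix.mulVec_mulVec, Matrix.mul_nonsing_inv _ hu, Matrix.one_mulVec]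
  have e1 : ∑ j, (W j ⬝ᵥ q) ^ 2 = u ⬝ᵥ q := by
    conv_rhs => rw [← hAq]
    rw [← Matrix.mulVec_mulVec, Matrix.mulVec_transpose, ← Matrix.dotProduct_mulVec]
    simp only [dotProduct, Matrix.mulVec, sq]
  refine ⟨e1, fun k => ?_⟩
  have h2 := h.dotProduct_mulVec_nonneg q
  rw [Matrix.sub_mulVec, dotProduct_sub, hAq, Matrix.smul_mulVec, Matrix.one_mulVec,
    dotProduct_smul] at h2
  have h3 : (q k) ^ 2 ≤ q ⬝ᵥ q := by
    have := Finset.single_le_sum (f := fun k => q k * q k) (fun i _ => mul_self_nonneg _)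
      (Finset.mem_univ k)
    simpa [dotProduct, sq] using this
  simp only [star_trivial, smul_eq_mul] at h2
  rw [le_div_iff₀ hκ, dotProduct_comm u]
  nlinarith

lemma fin_ineq (v G b X : ℝ) (hv : 0 < v) (hG : 0 < G) (hb : 0 < b) (hX : 0 ≤ X)
    (h : v * Real.pi ^ 2 ≤ X * (G * b)) :
    (1 - X) * (v * G) ≤ G ^ 2 / (G / v + Real.pi ^ 2 / b) := by
  have hp := Real.pi_pos
  have e : G ^ 2 / (G / v + Real.pi ^ 2 / b) = (v * G) * (G * b / (G * b + v * Real.pi ^ 2)) := by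
    field_simp
  rw [e, mul_comm]
  refine mul_le_mul_of_nonneg_left ?_ (by positivity)
  rw [le_div_iff₀ (by positivity)]
  have : 0 ≤ X * (v * Real.pi ^ 2) := by positivity
  nlinarith

lemma scale_ineq (N T N1 T1 w cl cu σ : ℝ) (hN : 0 < N) (hT : 0 < T) (hN1 : 0 < N1) (hT1 : 0 < T1)
    (hcl : 0 < cl) (hcu : cl ≤ cu) (hσ : 0 < σ) :
    w ^ 2 / (N * T) * Real.pi ^ 2 ≤ cu * Real.pi ^ 2 / cl ^ 2 *
      ((w / σ) / Real.sqrt (min N1 T1)) ^ 2 *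
      ((Real.sqrt σ * max (Real.sqrt N)⁻¹ (Real.sqrt T)⁻¹) ^ 2 * σ * cl * min (T1 / T) (N1 / N)) := by
  have hn : 0 < min N1 T1 := lt_min hN1 hT1
  set n := min N1 T1 with hnd
  set m := min (T1 / T) (N1 / N) with hmd
  set M := max (Real.sqrt N)⁻¹ (Real.sqrt T)⁻¹ with hMd
  have hm : 0 < m := lt_min (by positivity) (by positivity)
  have hM1 : N⁻¹ ≤ M ^ 2 := by
    rw [← Real.sq_sqrt hN.le, ← inv_pow]
    exact pow_le_pow_left₀ (by positivity) (le_max_left _ _) 2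
  have hM2 : T⁻¹ ≤ M ^ 2 := by
    rw [← Real.sq_sqrt hT.le, ← inv_pow]
    exact pow_le_pow_left₀ (by positivity) (le_max_right _ _) 2
  have key : n ≤ N * T * (M ^ 2 * m) := by
    rcases min_choice (T1 / T) (N1 / N) with hc | hc
    · have : N⁻¹ * (T1 / T) ≤ M ^ 2 * m := by rw [hmd, hc]; gcongr
      calc n ≤ T1 := min_le_right _ _
        _ = N * T * (N⁻¹ * (T1 / T)) := by field_simp
        _ ≤ _ := by gcongr
    · have : T⁻¹ * (N1 / N) ≤ M ^ 2 * m := by rw [hmd, hc]; gcongr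
      calc n ≤ N1 := min_le_left _ _
        _ = N * T * (T⁻¹ * (N1 / N)) := by field_simp
        _ ≤ _ := by gcongr
  have h1 : 1 / (N * T) ≤ M ^ 2 * m / n := by
    rw [div_le_div_iff₀ (by positivity) hn]; linarith
  have h2 : 1 / (N * T) ≤ cu / cl * (M ^ 2 * m / n) := by
    have : 1 ≤ cu / cl := by rwa [one_le_div hcl]
    have h0 : 0 ≤ M ^ 2 * m / n := by positivity
    nlinarith
  have e : cu * Real.pi ^ 2 / cl ^ 2 * ((w / σ) / Real.sqrt n) ^ 2 *
      ((Real.sqrt σ * M) ^ 2 * σ * cl * m)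
      = w ^ 2 * Real.pi ^ 2 * (cu / cl * (M ^ 2 * m / n)) := by
    rw [div_pow, Real.sq_sqrt hn.le, mul_pow, Real.sq_sqrt hσ.le]
    field_simp
  rw [e]
  calc w ^ 2 / (N * T) * Real.pi ^ 2 = w ^ 2 * Real.pi ^ 2 * (1 / (N * T)) := by ring
    _ ≤ _ := by gcongr

/-- genie-aided local minimax lower bound (Theorem `thm:CRLB`). -/
theorem stmt2 (N T N1 T1 r : ℕ) (hN1 : 0 < N1) (hNlt : N1 < N) (hT1 : 0 < T1) (hTlt : T1 < T)
    (hr : 0 < r) (w cl cu σr : ℝ) (hw : 0 < w) (hcl : 0 < cl) (hcu : cl ≤ cu)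
    (Ustar : Matrix (Fin N) (Fin r) ℝ) (sstar : Fin r → ℝ) (Vstar : Matrix (Fin T) (Fin r) ℝ)
    (Mstar : Matrix (Fin N) (Fin T) ℝ)
    (hUorth : Ustarᵀ * Ustar = 1) (hVorth : Vstarᵀ * Vstar = 1)
    (hsdec : ∀ k l : Fin r, k ≤ l → sstar l ≤ sstar k) (hspos : ∀ k, 0 < sstar k)
    (hM : Mstar = Ustar * Matrix.diagonal sstar * Vstarᵀ)
    (hσr : σr = sstar ⟨r - 1, by omega⟩)
    (hsub1 : ((topRows hNlt.le Ustar)ᵀ * topRows hNlt.le Ustar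
        - (cl * N1 / N) • (1 : Matrix (Fin r) (Fin r) ℝ)).PosSemidef)
    (hsub2 : ((cu * N1 / N) • (1 : Matrix (Fin r) (Fin r) ℝ)
        - (topRows hNlt.le Ustar)ᵀ * topRows hNlt.le Ustar).PosSemidef)
    (hsub3 : ((topRows hTlt.le Vstar)ᵀ * topRows hTlt.le Vstar
        - (cl * T1 / T) • (1 : Matrix (Fin r) (Fin r) ℝ)).PosSemidef)
    (hsub4 : ((cu * T1 / T) • (1 : Matrix (Fin r) (Fin r) ℝ)
        - (topRows hTlt.le Vstar)ᵀ * topRows hTlt.le Vstar).PosSemidef)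
    (i : Fin N) (t : Fin T) (hi : N1 ≤ i.1) (ht : T1 ≤ t.1) :
    -- genie-aided observation model and local minimax risk
    let v : NNReal := Real.toNNReal (w ^ 2 / (N * T))
    let Xs : Fin N → Fin r → ℝ := fun a k => Ustar a k * Real.sqrt (sstar k)
    let Ys : Fin T → Fin r → ℝ := fun b k => Vstar b k * Real.sqrt (sstar k)
    let xstar : Fin r → ℝ := Xs i
    let ystar : Fin r → ℝ := Ys t
    let model : (Fin r → ℝ) → (Fin r → ℝ) → Measure ((Fin T1 → ℝ) × (Fin N1 → ℝ)) :=
      fun x y =>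
        (Measure.pi fun s : Fin T1 => gaussianReal (x ⬝ᵥ Ys (Fin.castLE hTlt.le s)) v).prod
          (Measure.pi fun j : Fin N1 => gaussianReal (Xs (Fin.castLE hNlt.le j) ⬝ᵥ y) v)
    let ε : ℝ := Real.sqrt σr * max (Real.sqrt (N : ℝ))⁻¹ (Real.sqrt (T : ℝ))⁻¹
    let Rloc : ℝ≥0∞ :=
      ⨅ f : {f : (Fin T1 → ℝ) × (Fin N1 → ℝ) → ℝ // Measurable f},
        ⨆ p : {p : (Fin r → ℝ) × (Fin r → ℝ) //
            (∀ k, |p.1 k - xstar k| ≤ ε) ∧ (∀ k, |p.2 k - ystar k| ≤ ε)},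
          ∫⁻ z, ENNReal.ofReal ((f.1 z - p.1.1 ⬝ᵥ p.1.2) ^ 2) ∂(model p.1.1 p.1.2)
    let εNT : ℝ := (w / σr) / Real.sqrt (min (N1 : ℝ) T1)
    let U1s := topRows hNlt.le Ustar
    let V1s := topRows hTlt.le Vstar
    let γ : ℝ := (w ^ 2 / (N * T)) *
        (Ustar i ⬝ᵥ (U1sᵀ * U1s)⁻¹.mulVec (Ustar i)
          + Vstar t ⬝ᵥ (V1sᵀ * V1s)⁻¹.mulVec (Vstar t))
    ENNReal.ofReal ((1 - cu * Real.pi ^ 2 / cl ^ 2 * εNT ^ 2) * γ) ≤ Rloc := by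
  intro v Xs Ys xstar ystar model ε Rloc εNT U1s V1s γ
  have hNp : (0 : ℝ) < N := by exact_mod_cast hN1.trans hNlt
  have hTp : (0 : ℝ) < T := by exact_mod_cast hT1.trans hTlt
  have hN1p : (0 : ℝ) < N1 := by exact_mod_cast hN1
  have hT1p : (0 : ℝ) < T1 := by exact_mod_cast hT1
  have hσp : 0 < σr := by rw [hσr]; exact hspos _
  have hσle : ∀ k, σr ≤ sstar k := fun k => by
    rw [hσr]; exact hsdec _ _ (Fin.mk_le_mk.2 (by omega) : k ≤ ⟨r - 1, _⟩)
  have hvr : (v : ℝ) = w ^ 2 / (N * T) := Real.coe_toNNReal _ (by positivity)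
  have hvpos : (0 : ℝ) < w ^ 2 / (N * T) := by positivity
  have hv0 : v ≠ 0 := by
    intro h0; rw [h0] at hvr; simp only [NNReal.coe_zero] at hvr; linarith
  obtain ⟨u1, u2⟩ := lin_alg U1s (cl * N1 / N) (by positivity) hsub1 (Ustar i)
  obtain ⟨v1, v2⟩ := lin_alg V1s (cl * T1 / T) (by positivity) hsub3 (Vstar t)
  have hγ : γ = w ^ 2 / (N * T) * (Ustar i ⬝ᵥ (U1sᵀ * U1s)⁻¹.mulVec (Ustar i)
          + Vstar t ⬝ᵥ (V1sᵀ * V1s)⁻¹.mulVec (Vstar t)) := rfl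
  set qU := (U1sᵀ * U1s)⁻¹.mulVec (Ustar i) with hqU
  set qV := (V1sᵀ * V1s)⁻¹.mulVec (Vstar t) with hqV
  have hGU : 0 ≤ Ustar i ⬝ᵥ qU := by rw [← u1]; positivity
  have hGV : 0 ≤ Vstar t ⬝ᵥ qV := by rw [← v1]; positivity
  set G := Ustar i ⬝ᵥ qU + Vstar t ⬝ᵥ qV with hG
  rcases (add_nonneg hGU hGV).eq_or_lt with h0 | hGpos
  · rw [hγ, hG, ← h0]; simp
  rw [← hG] at hGpos
  have hsq : ∀ k, Real.sqrt (sstar k) ≠ 0 := fun k => (Real.sqrt_pos.2 (hspos k)).ne'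
  let a : Fin r → ℝ := fun k => qV k / Real.sqrt (sstar k)
  let b : Fin r → ℝ := fun k => qU k / Real.sqrt (sstar k)
  have hbX : ∀ j, Xs j ⬝ᵥ b = Ustar j ⬝ᵥ qU := fun j => by
    simp only [dotProduct, Xs, b]
    refine Finset.sum_congr rfl fun k _ => ?_
    have := hsq k
    field_simp
  have haY : ∀ j, a ⬝ᵥ Ys j = Vstar j ⬝ᵥ qV := fun j => by
    simp only [dotProduct, Ys, a]
    refine Finset.sum_congr rfl fun k _ => ?_
    have := hsq k
    field_simp
  have hεpos : 0 < ε := by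
    have : 0 < max (Real.sqrt (N : ℝ))⁻¹ (Real.sqrt (T : ℝ))⁻¹ :=
      lt_max_of_lt_left (by positivity)
    have := Real.sqrt_pos.2 hσp
    positivity
  set m := min ((T1 : ℝ) / T) ((N1 : ℝ) / N) with hm
  have hmpos : 0 < m := lt_min (by positivity) (by positivity)
  have hB2 : 0 < ε ^ 2 * σr * cl * m / G := by positivity
  set B := Real.sqrt (ε ^ 2 * σr * cl * m / G) with hB
  have hBpos : 0 < B := Real.sqrt_pos.2 hB2
  have hBsq : B ^ 2 = ε ^ 2 * σr * cl * m / G := Real.sq_sqrt hB2.le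
  -- range bounds
  have hbound : ∀ (q : Fin r → ℝ) (g c : ℝ), 0 < c → m ≤ c → g ≤ G → 0 ≤ g →
      (∀ k, q k ^ 2 ≤ g / (cl * c)) → ∀ θ, |θ| ≤ B → ∀ k,
      |θ * (q k / Real.sqrt (sstar k))| ≤ ε := by
    intro q g c hc hmc hgG hg hq θ hθ k
    refine abs_le_of_sq_le_sq ?_ hεpos.le
    have hθ2 : θ ^ 2 ≤ B ^ 2 := by rw [← sq_abs θ]; gcongr
    rw [mul_pow, div_pow, Real.sq_sqrt (hspos k).le]
    have h1 : q k ^ 2 / sstar k ≤ (G / (cl * m)) / σr := by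
      refine div_le_div₀ (by positivity) ?_ hσp (hσle k)
      refine (hq k).trans ?_
      gcongr
    calc θ ^ 2 * (q k ^ 2 / sstar k) ≤ B ^ 2 * ((G / (cl * m)) / σr) :=
          mul_le_mul hθ2 h1 (div_nonneg (sq_nonneg _) (hspos k).le) (sq_nonneg _)
      _ = ε ^ 2 := by rw [hBsq]; field_simp
  refine le_iInf fun f => ?_
  obtain ⟨f, hf⟩ := f
  set R := (⨆ p : {p : (Fin r → ℝ) × (Fin r → ℝ) //
            (∀ k, |p.1 k - xstar k| ≤ ε) ∧ (∀ k, |p.2 k - ystar k| ≤ ε)},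
          ∫⁻ z, ENNReal.ofReal ((f z - p.1.1 ⬝ᵥ p.1.2) ^ 2) ∂(model p.1.1 p.1.2)) with hR
  have tl := tilt_prod _ _ _ _ _ _
    (tilt_pi _ _ _ fun s : Fin T1 => tilt_gauss (xstar ⬝ᵥ Ys (Fin.castLE hTlt.le s))
      (a ⬝ᵥ Ys (Fin.castLE hTlt.le s)) v hv0)
    (tilt_pi _ _ _ fun j : Fin N1 => tilt_gauss (Xs (Fin.castLE hNlt.le j) ⬝ᵥ ystar)
      (Xs (Fin.castLE hNlt.le j) ⬝ᵥ b) v hv0)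
  have hI : ∑ s : Fin T1, (a ⬝ᵥ Ys (Fin.castLE hTlt.le s)) ^ 2 / (v : ℝ)
      + ∑ j : Fin N1, (Xs (Fin.castLE hNlt.le j) ⬝ᵥ b) ^ 2 / (v : ℝ)
      = G / (w ^ 2 / (N * T)) := by
    rw [← Finset.sum_div, ← Finset.sum_div, ← add_div, hvr, hG, ← u1, ← v1, add_comm]
    congr 2
    · exact Finset.sum_congr rfl fun j _ => by rw [hbX]; rfl
    · exact Finset.sum_congr rfl fun j _ => by rw [haY]; rfl
  rw [hI] at tl
  have hL : xstar ⬝ᵥ b + a ⬝ᵥ ystar = G := by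
    show Xs i ⬝ᵥ b + a ⬝ᵥ Ys t = G
    rw [hbX, haY]
  have vt := van_trees tl B hBpos f hf (xstar ⬝ᵥ ystar) G (a ⬝ᵥ b) R ?_
  · refine (ENNReal.ofReal_le_ofReal ?_).trans vt
    rw [hγ]
    refine fin_ineq _ _ _ _ hvpos hGpos (by positivity) ?_ ?_
    · have : 0 < cu := hcl.trans_le hcu
      positivity
    · have := scale_ineq N T N1 T1 w cl cu σr hNp hTp hN1p hT1p hcl hcu hσp
      have e : G * B ^ 2 = ε ^ 2 * σr * cl * m := by rw [hBsq]; field_simp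
      rw [e]
      exact this
  · intro θ hθ
    have hx : ∀ k, |(xstar + θ • a) k - xstar k| ≤ ε := fun k => by
      have := hbound qV (Vstar t ⬝ᵥ qV) (T1 / T) (by positivity) (min_le_left _ _) (by linarith) hGV
        (fun k => by rw [← mul_div_assoc]; exact v2 k) θ hθ k
      simpa [a] using this
    have hy : ∀ k, |(ystar + θ • b) k - ystar k| ≤ ε := fun k => by
      have := hbound qU (Ustar i ⬝ᵥ qU) (N1 / N) (by positivity) (min_le_right _ _) (by linarith) hGU
        (fun k => by rw [← mul_div_assoc]; exact u2 k) θ hθ k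
      simpa [b] using this
    refine le_trans (le_of_eq ?_) (le_iSup (fun p : {p : (Fin r → ℝ) × (Fin r → ℝ) //
            (∀ k, |p.1 k - xstar k| ≤ ε) ∧ (∀ k, |p.2 k - ystar k| ≤ ε)} =>
          ∫⁻ z, ENNReal.ofReal ((f z - p.1.1 ⬝ᵥ p.1.2) ^ 2) ∂(model p.1.1 p.1.2))
          ⟨(xstar + θ • a, ystar + θ • b), hx, hy⟩)
    have e1 : (xstar + θ • a) ⬝ᵥ (ystar + θ • b)
        = xstar ⬝ᵥ ystar + θ * G + θ ^ 2 * (a ⬝ᵥ b) := by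
      rw [← hL]
      simp only [add_dotProduct, dotProduct_add, smul_dotProduct, dotProduct_smul, smul_eq_mul]
      ring
    simp only [e1]
    congr 1
    simp only [model, add_dotProduct, dotProduct_add, smul_dotProduct, dotProduct_smul, smul_eq_mul]

end
end

section
/- Let M* ∈ ℝ^{N×T} be a rank-r matrix with SVD M* = U*Σ*V*ᵀ as in the four-block setup, and suppose the sub-block condition holds. Then the r-th largest singular values of the submatrices M*_left := [M*_a; M*_c] ∈ ℝ^{N×T1} and M*_upper := [M*_a M*_b] ∈ ℝ^{N1×T} satisfy √(c_ℓ·T1/T)·σr* ≤ σ_r(M*_left) ≤ √(c_u·T1/T)·σr* and √(c_ℓ·N1/N)·σr* ≤ σ_r(M*_upper) ≤ √(c_u·N1/N)·σr*. -/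
open Matrix MeasureTheory ProbabilityTheory
open scoped BigOperators ENNReal

noncomputable section

lemma aux_upper {m n : ℕ} {r : ℕ} (A : Matrix (Fin m) (Fin n) ℝ)
    (P : EuclideanSpace ℝ (Fin r) →ₗ[ℝ] EuclideanSpace ℝ (Fin m))
    (Q : EuclideanSpace ℝ (Fin r) →ₗ[ℝ] EuclideanSpace ℝ (Fin n))
    (R : EuclideanSpace ℝ (Fin n) →ₗ[ℝ] EuclideanSpace ℝ (Fin r))
    (D : EuclideanSpace ℝ (Fin r) →ₗ[ℝ] EuclideanSpace ℝ (Fin r))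
    (s : Fin r → ℝ) (j : Fin r)
    (hj : ∀ k, s j ≤ s k) (hs : 0 < s j)
    (hRQ : ∀ x y, inner ℝ (Q y) x = inner ℝ y (R x))
    (hD : ∀ y i, D y i = s i * y i)
    (hA : ∀ x, Matrix.toEuclideanLin A x = P (D (R x)))
    (b1 b2 : ℝ) (hb1 : 0 ≤ b1) (hb2 : 0 ≤ b2)
    (hP2 : ∀ y, ‖P y‖ ≤ b1 * ‖y‖) (hQ2 : ∀ y, ‖Q y‖ ≤ b2 * ‖y‖)
    (W : Submodule ℝ (EuclideanSpace ℝ (Fin n))) (hW : Module.finrank ℝ W = r) :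
    (⨅ x : {x : EuclideanSpace ℝ (Fin n) // x ∈ W ∧ ‖x‖ = 1},
      ‖Matrix.toEuclideanLin A x.1‖) ≤ b1 * b2 * s j := by
  have hR : ∀ x, ‖R x‖ ≤ b2 * ‖x‖ := by
    intro x
    have h1 := hRQ x (R x)
    rw [real_inner_self_eq_norm_sq] at h1
    have h2 := real_inner_le_norm (Q (R x)) x
    have h3 := hQ2 (R x)
    have h4 : ‖R x‖ * ‖R x‖ ≤ ‖R x‖ * (b2 * ‖x‖) := by
      nlinarith [norm_nonneg x, mul_le_mul_of_nonneg_right h3 (norm_nonneg x)]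
    rcases (norm_nonneg (R x)).eq_or_lt with h | h
    · rw [← h]; positivity
    · exact le_of_mul_le_mul_left h4 h
  -- nonzero witness
  have key : ∃ x ∈ W, x ≠ 0 ∧ ‖Matrix.toEuclideanLin A x‖ ≤ b1 * b2 * s j * ‖x‖ := by
    by_cases hinj : Function.Injective (R.comp W.subtype)
    · have hsurj : Function.Surjective (R.comp W.subtype) := by
        rwa [← LinearMap.injective_iff_surjective_of_finrank_eq_finrank]
        simp [hW]
      obtain ⟨x, hx⟩ := hsurj (EuclideanSpace.single j 1)
      have hx' : R x.1 = EuclideanSpace.single j 1 := hx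
      refine ⟨x.1, x.2, ?_, ?_⟩
      · intro h
        rw [h, map_zero] at hx'
        have := congrArg (fun v => v j) hx'
        simp at this
      · have hDe : D (R x.1) = s j • R x.1 := by
          rw [hx']
          ext i
          rw [hD]
          by_cases hij : i = j
          · subst hij; simp
          · simp [hij]
        rw [hA, hDe]
        refine (hP2 _).trans ?_
        rw [norm_smul, Real.norm_of_nonneg hs.le]
        have := mul_le_mul_of_nonneg_left (hR x.1) (mul_nonneg hb1 hs.le)
        nlinarith
    · rw [← LinearMap.ker_eq_bot, Submodule.eq_bot_iff] at hinj
      push Not at hinj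
      obtain ⟨x, hx, hx0⟩ := hinj
      have hx' : R x.1 = 0 := hx
      refine ⟨x.1, x.2, by simpa using hx0, ?_⟩
      rw [hA, hx', map_zero, map_zero, norm_zero]
      positivity
  obtain ⟨x, hxW, hx0, hx⟩ := key
  have hn : 0 < ‖x‖ := norm_pos_iff.mpr hx0
  have hu : ‖‖x‖⁻¹ • x‖ = 1 := by
    rw [norm_smul, norm_inv, norm_norm, inv_mul_cancel₀ hn.ne']
  refine (ciInf_le ⟨0, ?_⟩ ⟨‖x‖⁻¹ • x, W.smul_mem _ hxW, hu⟩).trans ?_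
  · rintro _ ⟨y, rfl⟩; exact norm_nonneg _
  · simp only [map_smul, norm_smul, norm_inv, norm_norm]
    rw [inv_mul_le_iff₀ hn]; linarith

lemma aux_core {m n : ℕ} {r : ℕ} (A : Matrix (Fin m) (Fin n) ℝ)
    (P : EuclideanSpace ℝ (Fin r) →ₗ[ℝ] EuclideanSpace ℝ (Fin m))
    (Q : EuclideanSpace ℝ (Fin r) →ₗ[ℝ] EuclideanSpace ℝ (Fin n))
    (R : EuclideanSpace ℝ (Fin n) →ₗ[ℝ] EuclideanSpace ℝ (Fin r))
    (D : EuclideanSpace ℝ (Fin r) →ₗ[ℝ] EuclideanSpace ℝ (Fin r))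
    (s : Fin r → ℝ) (j : Fin r)
    (hj : ∀ k, s j ≤ s k) (hs : 0 < s j)
    (hRQ : ∀ x y, inner ℝ (Q y) x = inner ℝ y (R x))
    (hD : ∀ y i, D y i = s i * y i)
    (hA : ∀ x, Matrix.toEuclideanLin A x = P (D (R x)))
    (a1 a2 b1 b2 : ℝ) (ha1 : 0 ≤ a1) (ha2 : 0 ≤ a2) (hb1 : 0 ≤ b1) (hb2 : 0 ≤ b2)
    (hP1 : ∀ y, a1 * ‖y‖ ≤ ‖P y‖) (hQ1 : ∀ y, a2 * ‖y‖ ≤ ‖Q y‖)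
    (hP2 : ∀ y, ‖P y‖ ≤ b1 * ‖y‖) (hQ2 : ∀ y, ‖Q y‖ ≤ b2 * ‖y‖) :
    a1 * a2 * s j ≤ sval A r ∧ sval A r ≤ b1 * b2 * s j := by
  have hup := aux_upper A P Q R D s j hj hs hRQ hD hA b1 b2 hb1 hb2 hP2 hQ2
  refine ⟨?_, Real.iSup_le (fun W => hup W.1 W.2) (by positivity)⟩
  rcases ha2.eq_or_lt with h0 | h0
  · rw [← h0, mul_zero, zero_mul]
    exact Real.iSup_nonneg (fun W => Real.iInf_nonneg (fun x => norm_nonneg _))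
  have hQinj : Function.Injective Q := by
    rw [← LinearMap.ker_eq_bot, Submodule.eq_bot_iff]
    intro y hy
    have h1 := hQ1 y
    rw [LinearMap.mem_ker.mp hy, norm_zero] at h1
    have : ‖y‖ ≤ 0 := by nlinarith [norm_nonneg y]
    simpa using this
  have hfr : Module.finrank ℝ (LinearMap.range Q) = r := by
    rw [LinearMap.finrank_range_of_inj hQinj]; simp
  refine le_trans ?_ (le_ciSup (f := fun W : {W : Submodule ℝ (EuclideanSpace ℝ (Fin n)) //
    Module.finrank ℝ ↥W = r} => ⨅ x : {x : EuclideanSpace ℝ (Fin n) // x ∈ W.1 ∧ ‖x‖ = 1},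
      ‖Matrix.toEuclideanLin A x.1‖) ⟨b1 * b2 * s j, ?_⟩ ⟨LinearMap.range Q, hfr⟩)
  swap
  · rintro _ ⟨W, rfl⟩; exact hup W.1 W.2
  have hne : Nonempty {x : EuclideanSpace ℝ (Fin n) // x ∈ LinearMap.range Q ∧ ‖x‖ = 1} := by
    have hx0 : Q (EuclideanSpace.single j 1) ≠ 0 := by
      intro h
      have h2 := hQinj (h.trans (map_zero Q).symm)
      have := congrArg (fun v => v j) h2
      simp at this
    have hn := norm_pos_iff.mpr hx0
    refine ⟨⟨‖Q (EuclideanSpace.single j 1)‖⁻¹ • Q (EuclideanSpace.single j 1),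
      Submodule.smul_mem _ _ ⟨_, rfl⟩, ?_⟩⟩
    rw [norm_smul, norm_inv, norm_norm, inv_mul_cancel₀ hn.ne']
  refine le_ciInf ?_
  rintro ⟨x, ⟨y, rfl⟩, hx1⟩
  show _ ≤ ‖Matrix.toEuclideanLin A (Q y)‖
  rw [hA]
  have hDn : ∀ z, s j * ‖z‖ ≤ ‖D z‖ := by
    intro z
    rw [← abs_of_pos hs, ← Real.norm_eq_abs, ← norm_smul]
    rw [EuclideanSpace.norm_eq, EuclideanSpace.norm_eq]
    apply Real.sqrt_le_sqrt
    apply Finset.sum_le_sum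
    intro i _
    rw [hD]
    simp only [PiLp.smul_apply, smul_eq_mul, norm_mul, mul_pow, Real.norm_eq_abs, sq_abs]
    have := hj i
    gcongr
  have hR : a2 ≤ ‖R (Q y)‖ := by
    have h1 := hRQ (Q y) y
    rw [real_inner_self_eq_norm_sq, hx1] at h1
    have h2 := real_inner_le_norm y (R (Q y))
    have h3 := hQ1 y
    rw [hx1] at h3
    nlinarith [mul_le_mul_of_nonneg_right h3 (norm_nonneg (R (Q y))), norm_nonneg y]
  calc a1 * a2 * s j = a1 * (s j * a2) := by ring
    _ ≤ a1 * (s j * ‖R (Q y)‖) := by gcongr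
    _ ≤ a1 * ‖D (R (Q y))‖ := by gcongr; exact hDn _
    _ ≤ _ := hP1 _

lemma aux_normsq {m r : ℕ} (P : Matrix (Fin m) (Fin r) ℝ) (y : EuclideanSpace ℝ (Fin r)) :
    ‖Matrix.toEuclideanLin P y‖ ^ 2 = y.ofLp ⬝ᵥ ((Pᵀ * P) *ᵥ y.ofLp) := by
  rw [← Matrix.mulVec_mulVec, Matrix.dotProduct_mulVec, Matrix.vecMul_transpose,
    EuclideanSpace.real_norm_sq_eq]
  simp [dotProduct, sq, Matrix.toLpLin_apply]

lemma aux_normsq' {r : ℕ} (y : EuclideanSpace ℝ (Fin r)) :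
    ‖y‖ ^ 2 = y.ofLp ⬝ᵥ y.ofLp := by
  rw [EuclideanSpace.real_norm_sq_eq]
  simp [dotProduct, sq]

lemma aux_low {m r : ℕ} (P : Matrix (Fin m) (Fin r) ℝ) (a : ℝ) (ha : 0 ≤ a)
    (h : (Pᵀ * P - a • (1 : Matrix (Fin r) (Fin r) ℝ)).PosSemidef)
    (y : EuclideanSpace ℝ (Fin r)) :
    Real.sqrt a * ‖y‖ ≤ ‖Matrix.toEuclideanLin P y‖ := by
  have h1 := h.dotProduct_mulVec_nonneg y.ofLp
  simp only [star_trivial, Matrix.sub_mulVec, dotProduct_sub, Matrix.smul_mulVec,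
    Matrix.one_mulVec, dotProduct_smul, smul_eq_mul, ← aux_normsq, ← aux_normsq'] at h1
  refine le_of_abs_le (abs_le_of_sq_le_sq ?_ (norm_nonneg _))
  rw [mul_pow, Real.sq_sqrt ha]; linarith

lemma aux_up {m r : ℕ} (P : Matrix (Fin m) (Fin r) ℝ) (a : ℝ) (ha : 0 ≤ a)
    (h : (a • (1 : Matrix (Fin r) (Fin r) ℝ) - Pᵀ * P).PosSemidef)
    (y : EuclideanSpace ℝ (Fin r)) :
    ‖Matrix.toEuclideanLin P y‖ ≤ Real.sqrt a * ‖y‖ := by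
  have h1 := h.dotProduct_mulVec_nonneg y.ofLp
  simp only [star_trivial, Matrix.sub_mulVec, dotProduct_sub, Matrix.smul_mulVec,
    Matrix.one_mulVec, dotProduct_smul, smul_eq_mul, ← aux_normsq, ← aux_normsq'] at h1
  refine le_of_abs_le (abs_le_of_sq_le_sq ?_ (by positivity))
  rw [mul_pow, Real.sq_sqrt ha]; linarith

lemma aux_mat {m n r : ℕ} (A : Matrix (Fin m) (Fin n) ℝ)
    (P : Matrix (Fin m) (Fin r) ℝ) (Q : Matrix (Fin n) (Fin r) ℝ)
    (s : Fin r → ℝ) (j : Fin r)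
    (hj : ∀ k, s j ≤ s k) (hs : 0 < s j)
    (hA : A = P * Matrix.diagonal s * Qᵀ)
    (a1 a2 b1 b2 : ℝ) (ha1 : 0 ≤ a1) (ha2 : 0 ≤ a2) (hb1 : 0 ≤ b1) (hb2 : 0 ≤ b2)
    (hP1 : (Pᵀ * P - a1 • (1 : Matrix (Fin r) (Fin r) ℝ)).PosSemidef)
    (hP2 : (b1 • (1 : Matrix (Fin r) (Fin r) ℝ) - Pᵀ * P).PosSemidef)
    (hQ1 : (Qᵀ * Q - a2 • (1 : Matrix (Fin r) (Fin r) ℝ)).PosSemidef)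
    (hQ2 : (b2 • (1 : Matrix (Fin r) (Fin r) ℝ) - Qᵀ * Q).PosSemidef) :
    Real.sqrt a1 * Real.sqrt a2 * s j ≤ sval A r ∧
      sval A r ≤ Real.sqrt b1 * Real.sqrt b2 * s j := by
  refine aux_core A (Matrix.toEuclideanLin P) (Matrix.toEuclideanLin Q)
    (Matrix.toEuclideanLin Qᵀ) (Matrix.toEuclideanLin (Matrix.diagonal s)) s j hj hs
    ?_ ?_ ?_ _ _ _ _ (Real.sqrt_nonneg _) (Real.sqrt_nonneg _) (Real.sqrt_nonneg _)
    (Real.sqrt_nonneg _) (aux_low P a1 ha1 hP1) (aux_low Q a2 ha2 hQ1)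
    (aux_up P b1 hb1 hP2) (aux_up Q b2 hb2 hQ2)
  · intro x y
    simp only [EuclideanSpace.inner_eq_star_dotProduct, star_trivial, Matrix.toLpLin_apply]
    rw [Matrix.dotProduct_mulVec, Matrix.mulVec_transpose]
  · intro y i
    simp [Matrix.toLpLin_apply, Matrix.mulVec_diagonal]
  · intro x
    simp [Matrix.toLpLin_apply, hA, Matrix.mulVec_mulVec, Matrix.mul_assoc]

/-- spectra of the sub-blocks `M*_left` and `M*_upper` under the
sub-block condition. -/
theorem stmt5 (N T N1 T1 r : ℕ) (hNlt : N1 < N) (hTlt : T1 < T) (hr : 0 < r)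
    (cl cu σr : ℝ) (hcl : 0 < cl) (hcu : cl ≤ cu)
    (Ustar : Matrix (Fin N) (Fin r) ℝ) (sstar : Fin r → ℝ) (Vstar : Matrix (Fin T) (Fin r) ℝ)
    (Mstar : Matrix (Fin N) (Fin T) ℝ)
    (hUorth : Ustarᵀ * Ustar = 1) (hVorth : Vstarᵀ * Vstar = 1)
    (hsdec : ∀ k l : Fin r, k ≤ l → sstar l ≤ sstar k) (hspos : ∀ k, 0 < sstar k)
    (hM : Mstar = Ustar * Matrix.diagonal sstar * Vstarᵀ)
    (hσr : σr = sstar ⟨r - 1, by omega⟩)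
    (hsub1 : ((topRows hNlt.le Ustar)ᵀ * topRows hNlt.le Ustar
        - (cl * N1 / N) • (1 : Matrix (Fin r) (Fin r) ℝ)).PosSemidef)
    (hsub2 : ((cu * N1 / N) • (1 : Matrix (Fin r) (Fin r) ℝ)
        - (topRows hNlt.le Ustar)ᵀ * topRows hNlt.le Ustar).PosSemidef)
    (hsub3 : ((topRows hTlt.le Vstar)ᵀ * topRows hTlt.le Vstar
        - (cl * T1 / T) • (1 : Matrix (Fin r) (Fin r) ℝ)).PosSemidef)
    (hsub4 : ((cu * T1 / T) • (1 : Matrix (Fin r) (Fin r) ℝ)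
        - (topRows hTlt.le Vstar)ᵀ * topRows hTlt.le Vstar).PosSemidef) :
    (Real.sqrt (cl * T1 / T) * σr ≤ sval (Mstar.submatrix id (Fin.castLE hTlt.le)) r ∧
      sval (Mstar.submatrix id (Fin.castLE hTlt.le)) r ≤ Real.sqrt (cu * T1 / T) * σr) ∧
    (Real.sqrt (cl * N1 / N) * σr ≤ sval (Mstar.submatrix (Fin.castLE hNlt.le) id) r ∧
      sval (Mstar.submatrix (Fin.castLE hNlt.le) id) r ≤ Real.sqrt (cu * N1 / N) * σr) := by
  have hj : ∀ k, sstar ⟨r - 1, by omega⟩ ≤ sstar k := fun k => hsdec _ _ (by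
    rw [Fin.le_def]; have := k.2; simp only; omega)
  have hU1 : (Ustarᵀ * Ustar - (1 : ℝ) • (1 : Matrix (Fin r) (Fin r) ℝ)).PosSemidef := by
    rw [hUorth, one_smul, sub_self]; exact Matrix.PosSemidef.zero
  have hU2 : ((1 : ℝ) • (1 : Matrix (Fin r) (Fin r) ℝ) - Ustarᵀ * Ustar).PosSemidef := by
    rw [hUorth, one_smul, sub_self]; exact Matrix.PosSemidef.zero
  have hV1 : (Vstarᵀ * Vstar - (1 : ℝ) • (1 : Matrix (Fin r) (Fin r) ℝ)).PosSemidef := by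
    rw [hVorth, one_smul, sub_self]; exact Matrix.PosSemidef.zero
  have hV2 : ((1 : ℝ) • (1 : Matrix (Fin r) (Fin r) ℝ) - Vstarᵀ * Vstar).PosSemidef := by
    rw [hVorth, one_smul, sub_self]; exact Matrix.PosSemidef.zero
  have hcu0 : 0 < cu := hcl.trans_le hcu
  subst hσr
  have h1 := aux_mat (Mstar.submatrix id (Fin.castLE hTlt.le)) Ustar (topRows hTlt.le Vstar)
    sstar ⟨r - 1, by omega⟩ hj (hspos _) (by
      rw [hM]; ext a b; simp [Matrix.mul_apply, topRows])
    1 (cl * T1 / T) 1 (cu * T1 / T) zero_le_one (by positivity) zero_le_one (by positivity)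
    hU1 hU2 hsub3 hsub4
  have h2 := aux_mat (Mstar.submatrix (Fin.castLE hNlt.le) id) (topRows hNlt.le Ustar) Vstar
    sstar ⟨r - 1, by omega⟩ hj (hspos _) (by
      rw [hM]; ext a b; simp [Matrix.mul_apply, topRows])
    (cl * N1 / N) 1 (cu * N1 / N) 1 (by positivity) zero_le_one (by positivity) zero_le_one
    hsub1 hsub2 hV1 hV2
  rw [Real.sqrt_one, one_mul, one_mul] at h1
  rw [Real.sqrt_one, mul_one, mul_one] at h2
  exact ⟨h1, h2⟩

end
end

section
/- Under the four-block setup (only the deterministic part is needed) and the sub-block condition, for any i with N1 < i ≤ N and any t with T1 < t ≤ T, the quantity v_{i,t} := (ω²/(NT))·‖V*_{t,·}(V1*ᵀV1*)^{-1}V1*ᵀ‖₂² + (ω²/(NT))·‖U*_{i,·}(U1*ᵀU1*)^{-1}U1*ᵀ‖₂² + (ω⁴/(N²T²))·tr[V1*(V1*ᵀV1*)^{-1}(Σ*)^{-1}(U1*ᵀU1*)^{-1}(Σ*)^{-1}(V1*ᵀV1*)^{-1}V1*ᵀ] satisfies v_{i,t} ≥ (1/c_u)·(ω²/(N·T1))·‖V*_{t,·}‖₂²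 + (1/c_u)·(ω²/(N1·T))·‖U*_{i,·}‖₂² + (1/c_u²)·(ω⁴/σr*²)·1/(N·T·N1·T1). -/
open Matrix MeasureTheory ProbabilityTheory
open scoped BigOperators ENNReal

noncomputable section

lemma aux_inv {r : ℕ} (B : Matrix (Fin r) (Fin r) ℝ) (d c : ℝ) (hd : 0 < d) (hc : 0 < c)
    (h1 : (B - d • (1 : Matrix (Fin r) (Fin r) ℝ)).PosSemidef)
    (h2 : (c • (1 : Matrix (Fin r) (Fin r) ℝ) - B).PosSemidef) :
    IsUnit B.det ∧ B⁻¹ᵀ = B⁻¹ ∧ (B⁻¹ - c⁻¹ • (1 : Matrix (Fin r) (Fin r) ℝ)).PosSemidef := by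
  have hB : B.PosDef := by
    have h3 : (d • (1 : Matrix (Fin r) (Fin r) ℝ)).PosDef := Matrix.PosDef.one.smul hd
    have := h3.add_posSemidef h1
    simpa using this
  have hu : IsUnit B.det := hB.det_pos.ne'.isUnit
  have hsym : B⁻¹ᵀ = B⁻¹ := by
    have := hB.inv.isHermitian.eq
    simpa [Matrix.conjTranspose_eq_transpose_of_trivial] using this
  refine ⟨hu, hsym, ?_⟩
  set D := B⁻¹ - c⁻¹ • (1 : Matrix (Fin r) (Fin r) ℝ) with hD
  have hDt : Dᴴ = D := by
    rw [Matrix.conjTranspose_eq_transpose_of_trivial, hD]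
    simp [hsym]
  have key : D = Dᴴ * B * D + (c⁻¹ ^ 2) • (c • (1 : Matrix (Fin r) (Fin r) ℝ) - B) := by
    rw [hDt]
    have e1 : D * B = 1 - c⁻¹ • B := by
      simp [hD, sub_mul, Matrix.nonsing_inv_mul _ hu]
    rw [e1, hD]
    simp only [sub_mul, mul_sub, one_mul, mul_one, smul_mul_assoc, mul_smul_comm,
      Matrix.mul_nonsing_inv _ hu, smul_sub, smul_smul]
    have : c⁻¹ ^ 2 * c = c⁻¹ := by field_simp
    rw [this, ← pow_two]
    abel
  rw [key]
  exact (hB.posSemidef.conjTranspose_mul_mul_same D).add (h2.smul (by positivity))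

lemma aux_vn {n : Type*} [Fintype n] (v : n → ℝ) : vnorm v ^ 2 = v ⬝ᵥ v := by
  unfold vnorm
  rw [Real.sq_sqrt (Finset.sum_nonneg fun _ _ => sq_nonneg _)]
  simp [dotProduct, pow_two]

lemma aux_norm {m r : ℕ} (V : Matrix (Fin m) (Fin r) ℝ) (a : ℝ) (x : Fin r → ℝ)
    (hu : IsUnit (Vᵀ * V).det) (hs : (Vᵀ * V)⁻¹ᵀ = (Vᵀ * V)⁻¹)
    (h : ((Vᵀ * V)⁻¹ - a • (1 : Matrix (Fin r) (Fin r) ℝ)).PosSemidef) :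
    a * vnorm x ^ 2 ≤ vnorm (V.mulVec ((Vᵀ * V)⁻¹.mulVec x)) ^ 2 := by
  rw [aux_vn, aux_vn]
  have e : (V.mulVec ((Vᵀ * V)⁻¹.mulVec x)) ⬝ᵥ (V.mulVec ((Vᵀ * V)⁻¹.mulVec x))
      = x ⬝ᵥ ((Vᵀ * V)⁻¹.mulVec x) := by
    rw [Matrix.dotProduct_mulVec, ← Matrix.mulVec_transpose, Matrix.mulVec_mulVec,
      Matrix.mulVec_mulVec, Matrix.mul_nonsing_inv _ hu, Matrix.one_mulVec]
  have := h.dotProduct_mulVec_nonneg x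
  simp [Matrix.sub_mulVec, Matrix.smul_mulVec, dotProduct_sub] at this
  rw [e]; linarith

lemma aux_conj {m r : ℕ} (P : Matrix (Fin r) (Fin r) ℝ) (X : Matrix (Fin r) (Fin m) ℝ) (b : ℝ)
    (h : (P - b • (1 : Matrix (Fin r) (Fin r) ℝ)).PosSemidef) :
    b * Matrix.trace (Xᵀ * X) ≤ Matrix.trace (Xᵀ * P * X) := by
  have := (h.conjTranspose_mul_mul_same X).trace_nonneg
  rw [Matrix.conjTranspose_eq_transpose_of_trivial] at this
  simp only [Matrix.mul_sub, Matrix.sub_mul, Matrix.trace_sub, Matrix.mul_smul, Matrix.smul_mul, Matrix.mul_one, Matrix.trace_smul, smul_eq_mul] at this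
  linarith

/-- deterministic lower bound on the variance `v_{i,t}` of `Z_{i,t}`. -/
theorem stmt10 (N T N1 T1 r : ℕ) (hNlt : N1 < N) (hTlt : T1 < T) (hr : 0 < r)
    (cl cu σr w : ℝ) (hcl : 0 < cl) (hcu : cl ≤ cu) (hw : 0 < w)
    (Ustar : Matrix (Fin N) (Fin r) ℝ) (sstar : Fin r → ℝ) (Vstar : Matrix (Fin T) (Fin r) ℝ)
    (Mstar : Matrix (Fin N) (Fin T) ℝ)
    (hUorth : Ustarᵀ * Ustar = 1) (hVorth : Vstarᵀ * Vstar = 1)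
    (hsdec : ∀ k l : Fin r, k ≤ l → sstar l ≤ sstar k) (hspos : ∀ k, 0 < sstar k)
    (hM : Mstar = Ustar * Matrix.diagonal sstar * Vstarᵀ)
    (hσr : σr = sstar ⟨r - 1, by omega⟩)
    (hsub1 : ((topRows hNlt.le Ustar)ᵀ * topRows hNlt.le Ustar
        - (cl * N1 / N) • (1 : Matrix (Fin r) (Fin r) ℝ)).PosSemidef)
    (hsub2 : ((cu * N1 / N) • (1 : Matrix (Fin r) (Fin r) ℝ)
        - (topRows hNlt.le Ustar)ᵀ * topRows hNlt.le Ustar).PosSemidef)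
    (hsub3 : ((topRows hTlt.le Vstar)ᵀ * topRows hTlt.le Vstar
        - (cl * T1 / T) • (1 : Matrix (Fin r) (Fin r) ℝ)).PosSemidef)
    (hsub4 : ((cu * T1 / T) • (1 : Matrix (Fin r) (Fin r) ℝ)
        - (topRows hTlt.le Vstar)ᵀ * topRows hTlt.le Vstar).PosSemidef)
    (i : Fin N) (t : Fin T) (hi : N1 ≤ i.1) (ht : T1 ≤ t.1) :
    let U1s := topRows hNlt.le Ustar
    let V1s := topRows hTlt.le Vstar
    let v : ℝ := (w ^ 2 / (N * T)) * vnorm (V1s.mulVec ((V1sᵀ * V1s)⁻¹.mulVec (Vstar t))) ^ 2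
      + (w ^ 2 / (N * T)) * vnorm (U1s.mulVec ((U1sᵀ * U1s)⁻¹.mulVec (Ustar i))) ^ 2
      + (w ^ 4 / ((N : ℝ) ^ 2 * (T : ℝ) ^ 2)) *
          Matrix.trace (V1s * (V1sᵀ * V1s)⁻¹ * (Matrix.diagonal sstar)⁻¹ * (U1sᵀ * U1s)⁻¹ *
            (Matrix.diagonal sstar)⁻¹ * (V1sᵀ * V1s)⁻¹ * V1sᵀ)
    (1 / cu) * (w ^ 2 / (N * T1)) * vnorm (Vstar t) ^ 2
      + (1 / cu) * (w ^ 2 / (N1 * T)) * vnorm (Ustar i) ^ 2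
      + (1 / cu ^ 2) * (w ^ 4 / σr ^ 2) * (1 / ((N : ℝ) * T * N1 * T1)) ≤ v := by
  intro U1s V1s v
  have hcu0 : 0 < cu := hcl.trans_le hcu
  have hN : (0 : ℝ) < N := by exact_mod_cast (Nat.zero_le _).trans_lt hNlt
  have hT : (0 : ℝ) < T := by exact_mod_cast (Nat.zero_le _).trans_lt hTlt
  have hU : 0 < N1 → _ := fun h : 0 < N1 => by
    have h' : (0 : ℝ) < N1 := by exact_mod_cast h
    exact aux_inv _ _ _ (by positivity) (by positivity) hsub1 hsub2
  have hV : 0 < T1 → _ := fun h : 0 < T1 => by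
    have h' : (0 : ℝ) < T1 := by exact_mod_cast h
    exact aux_inv _ _ _ (by positivity) (by positivity) hsub3 hsub4
  have hσ : 0 < σr := hσr ▸ hspos _
  have hDs : (Matrix.diagonal sstar)⁻¹ = Matrix.diagonal (fun k => (sstar k)⁻¹) := by
    apply Matrix.inv_eq_right_inv
    rw [Matrix.diagonal_mul_diagonal, ← Matrix.diagonal_one]
    congr 1
    funext k
    exact mul_inv_cancel₀ (hspos k).ne'
  have t1 : (1 / cu) * (w ^ 2 / (N * T1)) * vnorm (Vstar t) ^ 2 ≤
      (w ^ 2 / (N * T)) * vnorm (V1s.mulVec ((V1sᵀ * V1s)⁻¹.mulVec (Vstar t))) ^ 2 := by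
    rcases Nat.eq_zero_or_pos T1 with h | h
    · have : (T1 : ℝ) = 0 := by exact_mod_cast h
      rw [this]; simp; positivity
    · obtain ⟨a, b, c⟩ := hV h
      have h' : (0 : ℝ) < T1 := by exact_mod_cast h
      have := mul_le_mul_of_nonneg_left (aux_norm V1s _ (Vstar t) a b c)
        (show 0 ≤ w ^ 2 / (N * T : ℝ) by positivity)
      refine le_trans (le_of_eq ?_) this
      field_simp
  have t2 : (1 / cu) * (w ^ 2 / (N1 * T)) * vnorm (Ustar i) ^ 2 ≤
      (w ^ 2 / (N * T)) * vnorm (U1s.mulVec ((U1sᵀ * U1s)⁻¹.mulVec (Ustar i))) ^ 2 := by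
    rcases Nat.eq_zero_or_pos N1 with h | h
    · have : (N1 : ℝ) = 0 := by exact_mod_cast h
      rw [this]; simp; positivity
    · obtain ⟨a, b, c⟩ := hU h
      have h' : (0 : ℝ) < N1 := by exact_mod_cast h
      have := mul_le_mul_of_nonneg_left (aux_norm U1s _ (Ustar i) a b c)
        (show 0 ≤ w ^ 2 / (N * T : ℝ) by positivity)
      refine le_trans (le_of_eq ?_) this
      field_simp
  have t3 : (1 / cu ^ 2) * (w ^ 4 / σr ^ 2) * (1 / ((N : ℝ) * T * N1 * T1)) ≤
      (w ^ 4 / ((N : ℝ) ^ 2 * (T : ℝ) ^ 2)) *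
          Matrix.trace (V1s * (V1sᵀ * V1s)⁻¹ * (Matrix.diagonal sstar)⁻¹ * (U1sᵀ * U1s)⁻¹ *
            (Matrix.diagonal sstar)⁻¹ * (V1sᵀ * V1s)⁻¹ * V1sᵀ) := by
    have hsymV : (V1sᵀ * V1s)⁻¹ᵀ = (V1sᵀ * V1s)⁻¹ := by
      rw [Matrix.transpose_nonsing_inv]; simp
    rw [hDs]
    set S : Matrix (Fin r) (Fin r) ℝ := Matrix.diagonal (fun k => (sstar k)⁻¹) with hS
    have hSt : Sᵀ = S := Matrix.diagonal_transpose _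
    set X := S * (V1sᵀ * V1s)⁻¹ * V1sᵀ with hX
    have hXt : Xᵀ = V1s * (V1sᵀ * V1s)⁻¹ * S := by
      rw [hX, Matrix.transpose_mul, Matrix.transpose_mul, hsymV, hSt, Matrix.transpose_transpose,
        Matrix.mul_assoc]
    have eX : V1s * (V1sᵀ * V1s)⁻¹ * S * (U1sᵀ * U1s)⁻¹ * S * (V1sᵀ * V1s)⁻¹ * V1sᵀ
        = Xᵀ * (U1sᵀ * U1s)⁻¹ * X := by
      rw [hXt, hX]; simp only [Matrix.mul_assoc]
    rw [eX]
    by_cases h0 : 0 < N1 ∧ 0 < T1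
    · obtain ⟨hn, ht1⟩ := h0
      obtain ⟨a, b, c⟩ := hU hn
      obtain ⟨a', b', c'⟩ := hV ht1
      have hn' : (0 : ℝ) < N1 := by exact_mod_cast hn
      have ht' : (0 : ℝ) < T1 := by exact_mod_cast ht1
      have q1 := aux_conj _ X _ c
      have q2 := aux_conj _ S _ c'
      have e1 : Matrix.trace (Xᵀ * X) = Matrix.trace (Sᵀ * (V1sᵀ * V1s)⁻¹ * S) := by
        rw [Matrix.trace_mul_comm, hXt, hX, hSt]
        congr 1
        calc S * (V1sᵀ * V1s)⁻¹ * V1sᵀ * (V1s * (V1sᵀ * V1s)⁻¹ * S)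
            = S * (V1sᵀ * V1s)⁻¹ * ((V1sᵀ * V1s) * (V1sᵀ * V1s)⁻¹) * S := by
              simp only [Matrix.mul_assoc]
          _ = _ := by rw [Matrix.mul_nonsing_inv _ a', Matrix.mul_one]
      have q3 : (σr⁻¹) ^ 2 ≤ Matrix.trace (Sᵀ * S) := by
        rw [hSt, hS, Matrix.diagonal_mul_diagonal, Matrix.trace_diagonal, hσr, pow_two]
        exact Finset.single_le_sum
          (f := fun k => (sstar k)⁻¹ * (sstar k)⁻¹) (fun k _ => mul_self_nonneg _)
          (Finset.mem_univ (⟨r - 1, by omega⟩ : Fin r))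
      have q4 : (cu * N1 / N)⁻¹ * ((cu * T1 / T)⁻¹ * (σr⁻¹) ^ 2) ≤
          Matrix.trace (Xᵀ * (U1sᵀ * U1s)⁻¹ * X) := by
        refine le_trans (mul_le_mul_of_nonneg_left ?_ (by positivity)) q1
        rw [e1]
        exact le_trans (mul_le_mul_of_nonneg_left q3 (by positivity)) q2
      refine le_trans (le_of_eq ?_) (mul_le_mul_of_nonneg_left q4 (by positivity))
      field_simp
    · have hz : (1 / ((N : ℝ) * T * N1 * T1)) = 0 := by
        have : N1 = 0 ∨ T1 = 0 := by omega
        rcases this with h | h <;> simp [h]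
      rw [hz, mul_zero]
      apply mul_nonneg (by positivity)
      have hp : (U1sᵀ * U1s).PosSemidef := by
        simpa [Matrix.conjTranspose_eq_transpose_of_trivial] using
          Matrix.posSemidef_conjTranspose_mul_self U1s
      have := (hp.inv.conjTranspose_mul_mul_same X).trace_nonneg
      simpa [Matrix.conjTranspose_eq_transpose_of_trivial] using this
  exact add_le_add (add_le_add t1 t2) t3

end
end

section
/- In the staggered adoption setup, under the general sub-block condition, the submatrix M̄* := M*_{1:N̄, 1:T̄} (the top-left N̄ × T̄ corner of M*) satisfies c_ℓ·√(N̄·T̄/(N·T))·σr* ≤ σ_r(M̄*) ≤ c_u·√(N̄·T̄/(N·T))·σr*, where σ_r denotes the r-th largest singular value. -/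
open Matrix MeasureTheory ProbabilityTheory
open scoped BigOperators ENNReal

noncomputable section

lemma aux_norm_sq {n : Type*} [Fintype n] (v : EuclideanSpace ℝ n) :
    ‖v‖ ^ 2 = v.ofLp ⬝ᵥ v.ofLp := by
  rw [EuclideanSpace.norm_sq_eq]
  simp [dotProduct, sq]

lemma aux_dot_self_nonneg {n : Type*} [Fintype n] (v : n → ℝ) : 0 ≤ v ⬝ᵥ v :=
  Finset.sum_nonneg fun i _ => mul_self_nonneg (v i)

lemma aux_cs {n : Type*} [Fintype n] (v w : n → ℝ) :
    (v ⬝ᵥ w) ^ 2 ≤ (v ⬝ᵥ v) * (w ⬝ᵥ w) := by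
  have := Finset.sum_mul_sq_le_sq_mul_sq Finset.univ v w
  simpa [dotProduct, sq] using this

lemma aux_gram {m n : Type*} [Fintype m] [Fintype n] (A : Matrix m n ℝ) (y : n → ℝ) :
    y ⬝ᵥ ((Aᵀ * A) *ᵥ y) = (A *ᵥ y) ⬝ᵥ (A *ᵥ y) := by
  rw [← Matrix.mulVec_mulVec, Matrix.dotProduct_mulVec, Matrix.vecMul_transpose]

lemma aux_lower {m n : Type*} [Fintype m] [Fintype n] [DecidableEq n] (A : Matrix m n ℝ) (c : ℝ)
    (h : (Aᵀ * A - c • (1 : Matrix n n ℝ)).PosSemidef) (y : n → ℝ) :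
    c * (y ⬝ᵥ y) ≤ (A *ᵥ y) ⬝ᵥ (A *ᵥ y) := by
  have := h.dotProduct_mulVec_nonneg y
  rw [star_trivial, Matrix.sub_mulVec, dotProduct_sub, aux_gram, Matrix.smul_mulVec,
    Matrix.one_mulVec, dotProduct_smul, smul_eq_mul] at this
  linarith

lemma aux_upper_s15 {m n : Type*} [Fintype m] [Fintype n] [DecidableEq n] (A : Matrix m n ℝ) (c : ℝ)
    (h : (c • (1 : Matrix n n ℝ) - Aᵀ * A).PosSemidef) (y : n → ℝ) :
    (A *ᵥ y) ⬝ᵥ (A *ᵥ y) ≤ c * (y ⬝ᵥ y) := by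
  have := h.dotProduct_mulVec_nonneg y
  rw [star_trivial, Matrix.sub_mulVec, dotProduct_sub, aux_gram, Matrix.smul_mulVec,
    Matrix.one_mulVec, dotProduct_smul, smul_eq_mul] at this
  linarith

/-- transpose upper bound -/
lemma aux_upperT {m n : Type*} [Fintype m] [Fintype n] (B : Matrix m n ℝ) (c : ℝ) (hc : 0 ≤ c)
    (h : ∀ y, (B *ᵥ y) ⬝ᵥ (B *ᵥ y) ≤ c * (y ⬝ᵥ y)) (x : m → ℝ) :
    (Bᵀ *ᵥ x) ⬝ᵥ (Bᵀ *ᵥ x) ≤ c * (x ⬝ᵥ x) := by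
  set z := Bᵀ *ᵥ x with hz
  have h1 : z ⬝ᵥ z = x ⬝ᵥ (B *ᵥ z) := by
    rw [Matrix.dotProduct_mulVec x, ← Matrix.mulVec_transpose B x]
  have h2 := aux_cs x (B *ᵥ z)
  rw [← h1] at h2
  have h3 := h z
  have h4 := aux_dot_self_nonneg x
  have h5 := aux_dot_self_nonneg z
  rcases h5.eq_or_lt with h6 | h6
  · rw [← h6]; positivity
  · have h7 : (z ⬝ᵥ z) * (z ⬝ᵥ z) ≤ (c * (x ⬝ᵥ x)) * (z ⬝ᵥ z) := by
      nlinarith [mul_le_mul_of_nonneg_left h3 h4]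
    exact le_of_mul_le_mul_right h7 h6

/-- transpose lower bound on the range -/
lemma aux_lowerT {m n : Type*} [Fintype m] [Fintype n] (B : Matrix m n ℝ) (c : ℝ)
    (hc : 0 ≤ c)
    (h : ∀ y, c * (y ⬝ᵥ y) ≤ (B *ᵥ y) ⬝ᵥ (B *ᵥ y)) (y : n → ℝ) :
    c * ((B *ᵥ y) ⬝ᵥ (B *ᵥ y)) ≤ (Bᵀ *ᵥ (B *ᵥ y)) ⬝ᵥ (Bᵀ *ᵥ (B *ᵥ y)) := by
  set x := B *ᵥ y with hx
  have h1 : x ⬝ᵥ x = y ⬝ᵥ (Bᵀ *ᵥ x) := by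
    rw [Matrix.dotProduct_mulVec y, Matrix.vecMul_transpose]
  have h2 := aux_cs y (Bᵀ *ᵥ x)
  rw [← h1] at h2
  have h3 := h y
  rw [← hx] at h3
  have h4 := aux_dot_self_nonneg x
  have h5 := aux_dot_self_nonneg (Bᵀ *ᵥ x)
  rcases h4.eq_or_lt with h6 | h6
  · rw [← h6]; simpa using h5
  · have h7 : (c * (x ⬝ᵥ x)) * (x ⬝ᵥ x) ≤ ((Bᵀ *ᵥ x) ⬝ᵥ (Bᵀ *ᵥ x)) * (x ⬝ᵥ x) := by
      nlinarith [mul_le_mul_of_nonneg_right h3 h5, mul_le_mul_of_nonneg_left h2 hc]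
    exact le_of_mul_le_mul_right h7 h6

lemma aux_main {m n r : ℕ} (hr : 0 < r) (A : Matrix (Fin m) (Fin r) ℝ)
    (B : Matrix (Fin n) (Fin r) ℝ) (s : Fin r → ℝ) (σ al au bl bu : ℝ)
    (hσ : σ = s ⟨r - 1, by omega⟩)
    (hsdec : ∀ k l : Fin r, k ≤ l → s l ≤ s k) (hspos : ∀ k, 0 < s k)
    (hal : 0 ≤ al) (hau : 0 ≤ au) (hbl : 0 ≤ bl) (hbu : 0 ≤ bu)
    (hA1 : ∀ y, al * (y ⬝ᵥ y) ≤ (A *ᵥ y) ⬝ᵥ (A *ᵥ y))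
    (hA2 : ∀ y, (A *ᵥ y) ⬝ᵥ (A *ᵥ y) ≤ au * (y ⬝ᵥ y))
    (hB1 : ∀ y, bl * (y ⬝ᵥ y) ≤ (B *ᵥ y) ⬝ᵥ (B *ᵥ y))
    (hB2 : ∀ y, (B *ᵥ y) ⬝ᵥ (B *ᵥ y) ≤ bu * (y ⬝ᵥ y)) :
    Real.sqrt (al * bl) * σ ≤ sval (A * Matrix.diagonal s * Bᵀ) r ∧
    sval (A * Matrix.diagonal s * Bᵀ) r ≤ Real.sqrt (au * bu) * σ := by
  have hσ0 : 0 < σ := hσ ▸ hspos _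
  set M := A * Matrix.diagonal s * Bᵀ with hM
  have hMx : ∀ x : EuclideanSpace ℝ (Fin n), ‖Matrix.toEuclideanLin M x‖ ^ 2 =
      (A *ᵥ (Matrix.diagonal s *ᵥ (Bᵀ *ᵥ x.ofLp))) ⬝ᵥ
        (A *ᵥ (Matrix.diagonal s *ᵥ (Bᵀ *ᵥ x.ofLp))) := by
    intro x
    rw [aux_norm_sq, Matrix.ofLp_toEuclideanLin_apply, hM, Matrix.mulVec_mulVec,
      Matrix.mulVec_mulVec, Matrix.mul_assoc]
  have hbdd : ∀ W : Submodule ℝ (EuclideanSpace ℝ (Fin n)),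
      BddBelow (Set.range fun x : {x : EuclideanSpace ℝ (Fin n) // x ∈ W ∧ ‖x‖ = 1} =>
        ‖Matrix.toEuclideanLin M x.1‖) := by
    intro W
    exact ⟨0, by rintro _ ⟨x, rfl⟩; exact norm_nonneg _⟩
  have hup : ∀ W : {W : Submodule ℝ (EuclideanSpace ℝ (Fin n)) // Module.finrank ℝ ↥W = r},
      (⨅ x : {x : EuclideanSpace ℝ (Fin n) // x ∈ W.1 ∧ ‖x‖ = 1},
        ‖Matrix.toEuclideanLin M x.1‖) ≤ Real.sqrt (au * bu) * σ := by
    rintro ⟨W, hW⟩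
    let f : EuclideanSpace ℝ (Fin n) →ₗ[ℝ] (Fin (r - 1) → ℝ) :=
      (LinearMap.funLeft ℝ ℝ (Fin.castLE (show r - 1 ≤ r by omega))) ∘ₗ
        (Matrix.mulVecLin Bᵀ) ∘ₗ (WithLp.linearEquiv 2 ℝ (Fin n → ℝ)).toLinearMap
    have hker : LinearMap.ker (f ∘ₗ W.subtype) ≠ ⊥ := by
      apply LinearMap.ker_ne_bot_of_finrank_lt
      rw [hW]; simp; omega
    obtain ⟨w, hw, hw0⟩ := (Submodule.ne_bot_iff _).1 hker
    have hfw : f w.1 = 0 := by simpa using hw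
    have hw1 : (w : EuclideanSpace ℝ (Fin n)) ≠ 0 := by simpa using hw0
    have hn : ‖(w : EuclideanSpace ℝ (Fin n))‖ ≠ 0 := norm_ne_zero_iff.2 hw1
    set x : EuclideanSpace ℝ (Fin n) := ‖(w : EuclideanSpace ℝ (Fin n))‖⁻¹ • w.1 with hx
    have hxW : x ∈ W := W.smul_mem _ w.2
    have hx1 : ‖x‖ = 1 := by
      rw [hx, norm_smul, norm_inv, norm_norm, inv_mul_cancel₀ hn]
    have hfx : f x = 0 := by rw [hx, map_smul, hfw, smul_zero]
    refine (ciInf_le (hbdd W) ⟨x, hxW, hx1⟩).trans ?_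
    have hD : Matrix.diagonal s *ᵥ (Bᵀ *ᵥ x.ofLp) = σ • (Bᵀ *ᵥ x.ofLp) := by
      ext k
      rw [Matrix.mulVec_diagonal, Pi.smul_apply, smul_eq_mul]
      by_cases hk : k.1 < r - 1
      · have h0 := congrFun hfx ⟨k.1, hk⟩
        have h0' : (Bᵀ *ᵥ x.ofLp) k = 0 := h0
        rw [h0', mul_zero, mul_zero]
      · have : k = ⟨r - 1, by omega⟩ := by ext; simp; omega
        rw [hσ, this]
    have hxx : x.ofLp ⬝ᵥ x.ofLp = 1 := by rw [← aux_norm_sq, hx1]; norm_num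
    rw [← pow_le_pow_iff_left₀ (norm_nonneg _) (by positivity) two_ne_zero, hMx, hD, mul_pow,
      Real.sq_sqrt (by positivity)]
    have h1 := hA2 (σ • (Bᵀ *ᵥ x.ofLp))
    have h2 := aux_upperT B bu hbu hB2 x.ofLp
    rw [hxx] at h2
    refine h1.trans ?_
    rw [smul_dotProduct, dotProduct_smul, smul_eq_mul, smul_eq_mul]
    have := mul_le_mul_of_nonneg_left h2 (show 0 ≤ au * σ ^ 2 by positivity)
    nlinarith
  constructor
  · rcases (mul_nonneg hal hbl).eq_or_lt with h0 | h0
    · rw [← h0, Real.sqrt_zero, zero_mul]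
      exact Real.iSup_nonneg fun W => Real.iInf_nonneg fun x => norm_nonneg _
    · have hbl' : 0 < bl := lt_of_le_of_ne hbl (by rintro rfl; simp at h0)
      let g : (Fin r → ℝ) →ₗ[ℝ] EuclideanSpace ℝ (Fin n) :=
        (WithLp.linearEquiv 2 ℝ (Fin n → ℝ)).symm.toLinearMap ∘ₗ (Matrix.mulVecLin B)
      have hg : ∀ y, (g y).ofLp = B *ᵥ y := fun y => rfl
      have hginj : Function.Injective g := by
        rw [← LinearMap.ker_eq_bot, LinearMap.ker_eq_bot']
        intro y hy
        have h1 : B *ᵥ y = 0 := by rw [← hg, hy]; rfl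
        have h2 := hB1 y
        rw [h1, dotProduct_zero] at h2
        have h3 := aux_dot_self_nonneg y
        exact dotProduct_self_eq_zero.1 (by nlinarith)
      have hW : Module.finrank ℝ (LinearMap.range g) = r := by
        rw [LinearMap.finrank_range_of_inj hginj]; simp
      refine le_trans ?_ (le_ciSup (f := fun W : {W : Submodule ℝ (EuclideanSpace ℝ (Fin n)) //
          Module.finrank ℝ ↥W = r} => ⨅ x : {x : EuclideanSpace ℝ (Fin n) // x ∈ W.1 ∧ ‖x‖ = 1},
        ‖Matrix.toEuclideanLin M x.1‖) ⟨_, by rintro _ ⟨W, rfl⟩; exact hup W⟩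
        ⟨LinearMap.range g, hW⟩)
      have hne : Nonempty {x : EuclideanSpace ℝ (Fin n) // x ∈ LinearMap.range g ∧ ‖x‖ = 1} := by
        have : Nontrivial (LinearMap.range g) :=
          Module.nontrivial_of_finrank_pos (R := ℝ) (by omega)
        obtain ⟨w, hw0⟩ := exists_ne (0 : LinearMap.range g)
        have hw1 : (w : EuclideanSpace ℝ (Fin n)) ≠ 0 := by simpa using hw0
        refine ⟨⟨‖(w : EuclideanSpace ℝ (Fin n))‖⁻¹ • w.1, Submodule.smul_mem _ _ w.2, ?_⟩⟩
        rw [norm_smul, norm_inv, norm_norm, inv_mul_cancel₀ (norm_ne_zero_iff.2 hw1)]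
      refine le_ciInf ?_
      rintro ⟨x, ⟨y, rfl⟩, hx1⟩
      have hxx : (B *ᵥ y) ⬝ᵥ (B *ᵥ y) = 1 := by
        rw [← hg, ← aux_norm_sq, hx1]; norm_num
      rw [← pow_le_pow_iff_left₀ (by positivity) (norm_nonneg _) two_ne_zero, hMx, mul_pow,
        Real.sq_sqrt h0.le, hg]
      have h1 := aux_lowerT B bl hbl hB1 y
      rw [hxx] at h1
      set z := Bᵀ *ᵥ (B *ᵥ y) with hz
      have h2 : σ ^ 2 * (z ⬝ᵥ z) ≤ (Matrix.diagonal s *ᵥ z) ⬝ᵥ (Matrix.diagonal s *ᵥ z) := by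
        rw [dotProduct, dotProduct, Finset.mul_sum]
        refine Finset.sum_le_sum fun k _ => ?_
        rw [Matrix.mulVec_diagonal]
        have hk : σ ≤ s k := hσ ▸ hsdec k ⟨r - 1, by omega⟩ (by
          rw [Fin.le_def]; simp; omega)
        have := pow_le_pow_left₀ hσ0.le hk 2
        nlinarith [mul_le_mul_of_nonneg_right this (mul_self_nonneg (z k))]
      have h3 := hA1 (Matrix.diagonal s *ᵥ z)
      have h4 := mul_le_mul_of_nonneg_left h2 hal
      have h5 := mul_le_mul_of_nonneg_left h1 (show 0 ≤ al * σ ^ 2 by positivity)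
      nlinarith
  · exact Real.iSup_le hup (by positivity)

/-- spectrum of the top-left `N̄ × T̄` corner of `M*` under the
general sub-block condition. -/
theorem stmt15 (N T r Nb1 Nb2 Tb1 Tb2 : ℕ) (hr : 0 < r)
    (hNb : Nb1 + Nb2 ≤ N) (hTb : Tb1 + Tb2 ≤ T)
    (cl cu σr : ℝ) (hcl : 0 < cl) (hcu : cl ≤ cu)
    (Ustar : Matrix (Fin N) (Fin r) ℝ) (sstar : Fin r → ℝ) (Vstar : Matrix (Fin T) (Fin r) ℝ)
    (Mstar : Matrix (Fin N) (Fin T) ℝ)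
    (hUorth : Ustarᵀ * Ustar = 1) (hVorth : Vstarᵀ * Vstar = 1)
    (hsdec : ∀ k l : Fin r, k ≤ l → sstar l ≤ sstar k) (hspos : ∀ k, 0 < sstar k)
    (hM : Mstar = Ustar * Matrix.diagonal sstar * Vstarᵀ)
    (hσr : σr = sstar ⟨r - 1, by omega⟩)
    -- general sub-block condition
    (hsubU1a : ((topRows (show Nb1 ≤ N by omega) Ustar)ᵀ * topRows (show Nb1 ≤ N by omega) Ustar
        - (cl * Nb1 / N) • (1 : Matrix (Fin r) (Fin r) ℝ)).PosSemidef)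
    (hsubU1b : ((cu * Nb1 / N) • (1 : Matrix (Fin r) (Fin r) ℝ)
        - (topRows (show Nb1 ≤ N by omega) Ustar)ᵀ * topRows (show Nb1 ≤ N by omega) Ustar).PosSemidef)
    (hsubUa : ((topRows hNb Ustar)ᵀ * topRows hNb Ustar
        - (cl * (Nb1 + Nb2) / N) • (1 : Matrix (Fin r) (Fin r) ℝ)).PosSemidef)
    (hsubUb : ((cu * (Nb1 + Nb2) / N) • (1 : Matrix (Fin r) (Fin r) ℝ)
        - (topRows hNb Ustar)ᵀ * topRows hNb Ustar).PosSemidef)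
    (hsubV1a : ((topRows (show Tb1 ≤ T by omega) Vstar)ᵀ * topRows (show Tb1 ≤ T by omega) Vstar
        - (cl * Tb1 / T) • (1 : Matrix (Fin r) (Fin r) ℝ)).PosSemidef)
    (hsubV1b : ((cu * Tb1 / T) • (1 : Matrix (Fin r) (Fin r) ℝ)
        - (topRows (show Tb1 ≤ T by omega) Vstar)ᵀ * topRows (show Tb1 ≤ T by omega) Vstar).PosSemidef)
    (hsubVa : ((topRows hTb Vstar)ᵀ * topRows hTb Vstar
        - (cl * (Tb1 + Tb2) / T) • (1 : Matrix (Fin r) (Fin r) ℝ)).PosSemidef)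
    (hsubVb : ((cu * (Tb1 + Tb2) / T) • (1 : Matrix (Fin r) (Fin r) ℝ)
        - (topRows hTb Vstar)ᵀ * topRows hTb Vstar).PosSemidef) :
    cl * Real.sqrt ((Nb1 + Nb2) * (Tb1 + Tb2) / ((N : ℝ) * T)) * σr ≤
        sval (Mstar.submatrix (Fin.castLE hNb) (Fin.castLE hTb)) r ∧
      sval (Mstar.submatrix (Fin.castLE hNb) (Fin.castLE hTb)) r ≤
        cu * Real.sqrt ((Nb1 + Nb2) * (Tb1 + Tb2) / ((N : ℝ) * T)) * σr := by
  have hsub : Mstar.submatrix (Fin.castLE hNb) (Fin.castLE hTb) =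
      topRows hNb Ustar * Matrix.diagonal sstar * (topRows hTb Vstar)ᵀ := by
    subst hM
    ext i j
    simp [topRows, Matrix.mul_apply, Matrix.submatrix_apply]
  have hcu0 : 0 < cu := hcl.trans_le hcu
  have key : ∀ c : ℝ, 0 < c →
      c * Real.sqrt ((Nb1 + Nb2) * (Tb1 + Tb2) / ((N : ℝ) * T)) =
        Real.sqrt ((c * (Nb1 + Nb2) / N) * (c * (Tb1 + Tb2) / T)) := by
    intro c hc
    have : (c * (Nb1 + Nb2) / N) * (c * (Tb1 + Tb2) / T) =
        c ^ 2 * (((Nb1 + Nb2) * (Tb1 + Tb2) / ((N : ℝ) * T)) : ℝ) := by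
      rw [div_mul_div_comm]; ring
    rw [this, Real.sqrt_mul (sq_nonneg c), Real.sqrt_sq hc.le]
  rw [hsub, key cl hcl, key cu hcu0]
  exact aux_main hr _ _ sstar σr _ _ _ _ hσr hsdec hspos (by positivity) (by positivity)
    (by positivity) (by positivity) (aux_lower _ _ hsubUa) (aux_upper_s15 _ _ hsubUb)
    (aux_lower _ _ hsubVa) (aux_upper_s15 _ _ hsubVb)

end
end
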